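/- arXiv:2502.10791 — 2 statements merged into one kernel-verified Lean document; each statement's English description precedes it below -/
import Mathlib

section
/- Let k̄ be odd with 3 ≤ k̄ ≤ L/2 and let Q = Σ_{A∈P_Λ, Diag A ≤ k̄} q_A A satisfy [H,Q] = 0. Then for each base site u_1 the coefficients of the standard-form products alternate in sign: q_{C^{k̄}_j} = q_{C^{k̄}_1} for odd j and q_{C^{k̄}_j} = −q_{C^{k̄}_1} for even j. -/
open Complex Matrix

/-- Sites of the `L × L` square lattice with periodic boundary conditions. -/
abbrev Site (L : ℕ) := ZMod L × ZMod L

/-- A specification of a product of Pauli matrices: at each site either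
`0` (no operator), `1` (`X`), `2` (`Y`) or `3` (`Z`). -/
abbrev PSpec (L : ℕ) := Site L → Fin 4

/-- Operators on the Hilbert space `⊗_{u ∈ Λ} ℂ²`. -/
abbrev Op (L : ℕ) := Matrix (Site L → Fin 2) (Site L → Fin 2) ℂ

/-- The Pauli matrices (`0` gives the identity). -/
noncomputable def pauli (w : Fin 4) : Matrix (Fin 2) (Fin 2) ℂ :=
  if w = 1 then !![0, 1; 1, 0]
  else if w = 2 then !![0, -Complex.I; Complex.I, 0]
  else if w = 3 then !![1, 0; 0, -1]
  else 1

/-- The product of Pauli matrices specified by `σ`, as an operator (matrix)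
on the full Hilbert space. -/
noncomputable def PauliOp (L : ℕ) [NeZero L] (σ : PSpec L) : Op L :=
  fun s t => ∏ u : Site L, pauli (σ u) (s u) (t u)

/-- `DiagBoundAt L σ a k` : every site `u` in the support of `σ` satisfies
`0 ≤ uₓ + u_y − a ≤ k − 1 (mod L)`. -/
def DiagBoundAt (L : ℕ) (σ : PSpec L) (a : ZMod L) (k : ℕ) : Prop :=
  ∀ u : Site L, σ u ≠ 0 → (u.1 + u.2 - a).val < k

/-- The diagonal length of a Pauli product. -/
noncomputable def Diag (L : ℕ) (σ : PSpec L) : ℕ :=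
  sInf {k | ∃ a : ZMod L, DiagBoundAt L σ a k}

/-- `X_u` as a Pauli-product specification. -/
def sigX (L : ℕ) (u : Site L) : PSpec L := fun v => if v = u then 1 else 0
/-- `Y_u` as a Pauli-product specification. -/
def sigY (L : ℕ) (u : Site L) : PSpec L := fun v => if v = u then 2 else 0
/-- `Z_u` as a Pauli-product specification. -/
def sigZ (L : ℕ) (u : Site L) : PSpec L := fun v => if v = u then 3 else 0
/-- A single-site Pauli operator `W_u` (`w ∈ {1,2,3}`). -/
def sigW (L : ℕ) (u : Site L) (w : Fin 4) : PSpec L := fun v => if v = u then w else 0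

/-- `X_u X_{u+eₓ}` as a Pauli-product specification. -/
def sigXX (L : ℕ) (u : Site L) : PSpec L :=
  fun v => if v = u then 1 else if v = u + (1, 0) then 1 else 0
/-- `Y_u Y_{u+e_y}` as a Pauli-product specification. -/
def sigYY (L : ℕ) (u : Site L) : PSpec L :=
  fun v => if v = u then 2 else if v = u + (0, 1) then 2 else 0

/-- The quantum compass Hamiltonian
`H = −Σ_u (Jx X_u X_{u+eₓ} + Jy Y_u Y_{u+e_y})`. -/
noncomputable def Hcompass (L : ℕ) [NeZero L] (Jx Jy : ℝ) : Op L :=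
  - ∑ u : Site L, ((Jx : ℂ) • PauliOp L (sigXX L u) + (Jy : ℂ) • PauliOp L (sigYY L u))

/-- The quantum compass Hamiltonian with a uniform magnetic field. -/
noncomputable def Hfield (L : ℕ) [NeZero L] (Jx Jy hx hy hz : ℝ) : Op L :=
  - ∑ u : Site L,
      ((Jx : ℂ) • PauliOp L (sigXX L u) + (Jy : ℂ) • PauliOp L (sigYY L u)
        + (hx : ℂ) • PauliOp L (sigX L u) + (hy : ℂ) • PauliOp L (sigY L u)
        + (hz : ℂ) • PauliOp L (sigZ L u))

/-- The candidate conserved quantity `Q = Σ_σ q_σ σ`. -/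
noncomputable def Qop (L : ℕ) [NeZero L] (q : PSpec L → ℂ) : Op L :=
  ∑ σ : PSpec L, q σ • PauliOp L σ

/-- Commutator of operators. -/
noncomputable def opComm (L : ℕ) [NeZero L] (A B : Op L) : Op L := A * B - B * A

/-- The coefficient `λ_{σ,τ}` of the Pauli product `τ` in the expansion
`[H, σ] = Σ_τ λ_{σ,τ} τ`, extracted via the (normalized) trace inner product. -/
noncomputable def lam (L : ℕ) [NeZero L] (H : Op L) (σ τ : PSpec L) : ℂ :=
  Matrix.trace (PauliOp L τ * opComm L H (PauliOp L σ)) / (2 ^ Fintype.card (Site L))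

/-- `u` is a top-right site of `σ` (relative to the witness `a` for diagonal
length `k`). -/
def IsTopRight (L : ℕ) (σ : PSpec L) (a : ZMod L) (k : ℕ) (u : Site L) : Prop :=
  σ u ≠ 0 ∧ (u.1 + u.2 - a).val = k - 1

/-- `u` is a bottom-left site of `σ` (relative to the witness `a`). -/
def IsBottomLeft (L : ℕ) (σ : PSpec L) (a : ZMod L) (u : Site L) : Prop :=
  σ u ≠ 0 ∧ (u.1 + u.2 - a).val = 0

/-- Condition (1): `σ` has a unique top-right site `ū`, with
(1a) `σ_ū = X` and `ū − eₓ ∈ Supp σ`, or (1b) `σ_ū = Y` and `ū − e_y ∈ Supp σ`. -/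
def Cond1 (L : ℕ) (σ : PSpec L) (a : ZMod L) (k : ℕ) : Prop :=
  ∃ ub : Site L, (∀ v : Site L, IsTopRight L σ a k v ↔ v = ub) ∧
    ((σ ub = 1 ∧ σ (ub - (1, 0)) ≠ 0) ∨ (σ ub = 2 ∧ σ (ub - (0, 1)) ≠ 0))

/-- Condition (2): `σ` has a unique bottom-left site `u̲`, with
(2a) `σ_u̲ = X` and `u̲ + eₓ ∈ Supp σ`, or (2b) `σ_u̲ = Y` and `u̲ + e_y ∈ Supp σ`. -/
def Cond2 (L : ℕ) (σ : PSpec L) (a : ZMod L) : Prop :=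
  ∃ lb : Site L, (∀ v : Site L, IsBottomLeft L σ a v ↔ v = lb) ∧
    ((σ lb = 1 ∧ σ (lb + (1, 0)) ≠ 0) ∨ (σ lb = 2 ∧ σ (lb + (0, 1)) ≠ 0))

/-- `ShiftRel L k σ σ'` : `σ` has diagonal length `k`, satisfies conditions (1)
and (2), and `σ'` is the Shiraishi shift `S(σ)`, obtained by first appending a
site at the top right (the product `B`) and then truncating the bottom-left site. -/
def ShiftRel (L : ℕ) [NeZero L] (k : ℕ) (σ σ' : PSpec L) : Prop :=
  Diag L σ = k ∧ σ' ≠ 0 ∧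
  ∃ a : ZMod L, DiagBoundAt L σ a k ∧
  ∃ ub lb : Site L,
    (∀ v : Site L, IsTopRight L σ a k v ↔ v = ub) ∧
    (∀ v : Site L, IsBottomLeft L σ a v ↔ v = lb) ∧
    ∃ B : Op L,
      ((σ ub = 1 ∧ σ (ub - (1, 0)) ≠ 0 ∧
          B = (-(1 / (2 * Complex.I))) • opComm L (PauliOp L (sigYY L ub)) (PauliOp L σ)) ∨
       (σ ub = 2 ∧ σ (ub - (0, 1)) ≠ 0 ∧
          B = (1 / (2 * Complex.I)) • opComm L (PauliOp L (sigXX L ub)) (PauliOp L σ))) ∧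
      ∃ ε : ℂ, (ε = 1 / (2 * Complex.I) ∨ ε = -(1 / (2 * Complex.I))) ∧
        ((σ lb = 1 ∧ σ (lb + (1, 0)) ≠ 0 ∧
            PauliOp L σ' = ε • opComm L (PauliOp L (sigXX L lb)) B) ∨
         (σ lb = 2 ∧ σ (lb + (0, 1)) ≠ 0 ∧
            PauliOp L σ' = ε • opComm L (PauliOp L (sigYY L lb)) B))

/-- The staircase sequence `u_j`: `u_j = u₁ + ((j−1)/2)(eₓ+e_y)` for odd `j`,
and `u_j = u₁ + (j/2)(eₓ+e_y) − e_y` for even `j`. -/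
def stair (L : ℕ) (u1 : Site L) (j : ℕ) : Site L :=
  if j % 2 = 1 then
    u1 + ((((j - 1) / 2 : ℕ) : ZMod L), (((j - 1) / 2 : ℕ) : ZMod L))
  else
    u1 + (((j / 2 : ℕ) : ZMod L), ((j / 2 : ℕ) : ZMod L)) - ((0 : ZMod L), (1 : ZMod L))

/-- The Pauli letter at the first (bottom-left) end of `C^k_j`. -/
def endL (j : ℕ) : Fin 4 := if j % 2 = 1 then 1 else 2

/-- The Pauli letter at the last (top-right) end of `C^k_j`. -/
def endR (k j : ℕ) : Fin 4 :=
  if k % 2 = 1 then (if j % 2 = 1 then 2 else 1)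
  else (if j % 2 = 1 then 1 else 2)

/-- The standard-form product `C^k_j` based at `u₁`: the appropriate end
letters at `u_j` and `u_{j+k−1}`, and `Z` at `u_{j+1}, …, u_{j+k−2}`. -/
def Cspec (L : ℕ) (k j : ℕ) (u1 : Site L) : PSpec L := fun v =>
  if v = stair L u1 j then endL j
  else if v = stair L u1 (j + k - 1) then endR k j
  else if v ∈ (Finset.Icc (j + 1) (j + k - 2)).image (stair L u1) then 3
  else 0

/-- The operator with matrix entries `∏ u, M u (s u) (t u)`. -/
noncomputable def siteProd (L : ℕ) [NeZero L] (M : Site L → Matrix (Fin 2) (Fin 2) ℂ) : Op L :=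
  fun s t => ∏ u : Site L, M u (s u) (t u)

theorem siteProd_mul (L : ℕ) [NeZero L] (M N : Site L → Matrix (Fin 2) (Fin 2) ℂ) :
    siteProd L M * siteProd L N = siteProd L (fun u => M u * N u) := by
  ext s t
  simp only [siteProd, Matrix.mul_apply, ← Finset.prod_mul_distrib]
  rw [Finset.prod_univ_sum, Fintype.piFinset_univ]

theorem trace_siteProd (L : ℕ) [NeZero L] (M : Site L → Matrix (Fin 2) (Fin 2) ℂ) :
    Matrix.trace (siteProd L M) = ∏ u, Matrix.trace (M u) := by
  simp only [siteProd, Matrix.trace, Matrix.diag]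
  rw [Finset.prod_univ_sum, Fintype.piFinset_univ]

/-- The trace of a product of three Pauli matrices. -/
noncomputable def pauliTrace (a b c : Fin 4) : ℂ :=
  Matrix.trace (pauli a * pauli b * pauli c)

theorem trace_PauliOp_mul (L : ℕ) [NeZero L] (σ τ ρ : PSpec L) :
    Matrix.trace (PauliOp L σ * PauliOp L τ * PauliOp L ρ) =
      ∏ u, pauliTrace (σ u) (τ u) (ρ u) := by
  change Matrix.trace (siteProd L (fun u => pauli (σ u)) * siteProd L (fun u => pauli (τ u)) *
    siteProd L (fun u => pauli (ρ u))) = _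
  rw [siteProd_mul, siteProd_mul, trace_siteProd]
  rfl

theorem pauliTrace_eq_zero (a b c : Fin 4) (h : c ≠ a ^^^ b) : pauliTrace a b c = 0 := by
  revert h
  fin_cases a <;> fin_cases b <;> fin_cases c <;> intro h <;>
    first
    | exact absurd (by decide) h
    | simp [pauliTrace, pauli, Matrix.trace_fin_two]

theorem pauliTrace_comm_eq_zero (a b c : Fin 4) (h : c ≠ a ^^^ b) : pauliTrace b a c = 0 :=
  pauliTrace_eq_zero b a c (by revert h; revert a b c; decide)

theorem xor_comm_fin (a b : Fin 4) : a ^^^ b = b ^^^ a := by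
  revert a b; decide

theorem pauliTrace_of_trivial (a b : Fin 4) (h : a = 0 ∨ b = 0 ∨ a = b) :
    pauliTrace a b (a ^^^ b) = 2 := by
  revert h
  fin_cases a <;> fin_cases b <;> intro h <;>
    first
    | exact absurd h (by decide)
    | (simp [pauliTrace, pauli, Matrix.trace_fin_two]; try norm_num)

/-- The Pauli product proportional to the operator product of `σ` and `τ`. -/
def specMul {L : ℕ} (σ τ : PSpec L) : PSpec L := fun u => σ u ^^^ τ u

/-- The normalization-free trace of `[τ, ρ] (τρ)`, where `τρ` denotes `specMul τ ρ`. -/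
noncomputable def commTrace {L : ℕ} [NeZero L] (τ ρ : PSpec L) : ℂ :=
  ∏ u, pauliTrace (τ u) (ρ u) (τ u ^^^ ρ u) - ∏ u, pauliTrace (ρ u) (τ u) (τ u ^^^ ρ u)

theorem trace_PauliOp_opComm (L : ℕ) [NeZero L] (τ ρ σ : PSpec L) :
    Matrix.trace (opComm L (PauliOp L σ) (PauliOp L τ) * PauliOp L ρ) =
      if σ = specMul τ ρ then commTrace τ ρ else 0 := by
  have h : Matrix.trace (opComm L (PauliOp L σ) (PauliOp L τ) * PauliOp L ρ) =
      ∏ u, pauliTrace (τ u) (ρ u) (σ u) - ∏ u, pauliTrace (ρ u) (τ u) (σ u) := by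
    rw [← trace_PauliOp_mul, ← trace_PauliOp_mul, opComm, Matrix.sub_mul, Matrix.trace_sub,
      ← Matrix.trace_mul_cycle (PauliOp L τ) (PauliOp L ρ) (PauliOp L σ),
      Matrix.trace_mul_cycle (PauliOp L τ) (PauliOp L σ) (PauliOp L ρ)]
  rw [h]
  split_ifs with hσ
  · subst hσ
    rfl
  · obtain ⟨u, hu⟩ := Function.ne_iff.mp hσ
    rw [Finset.prod_eq_zero (Finset.mem_univ u) (pauliTrace_eq_zero _ _ _ hu),
      Finset.prod_eq_zero (Finset.mem_univ u) (pauliTrace_comm_eq_zero _ _ _ hu), sub_zero]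

theorem trace_Qop_opComm (L : ℕ) [NeZero L] (q : PSpec L → ℂ) (τ ρ : PSpec L) :
    Matrix.trace (opComm L (Qop L q) (PauliOp L τ) * PauliOp L ρ) =
      q (specMul τ ρ) * commTrace τ ρ := by
  have h : opComm L (Qop L q) (PauliOp L τ) =
      ∑ σ, q σ • opComm L (PauliOp L σ) (PauliOp L τ) := by
    simp only [opComm, Qop, Finset.sum_mul, Finset.mul_sum, smul_sub, Finset.sum_sub_distrib,
      Matrix.smul_mul, Matrix.mul_smul]
  rw [h, Finset.sum_mul, Matrix.trace_sum]
  simp only [Matrix.smul_mul, Matrix.trace_smul, trace_PauliOp_opComm, smul_eq_mul, mul_ite,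
    mul_zero, Finset.sum_ite_eq', Finset.mem_univ, if_true]

/-- The coefficient of `τ` in `[H, Q]` vanishes. -/
theorem sum_coeff_eq_zero (L : ℕ) [NeZero L] (Jx Jy : ℝ) (q : PSpec L → ℂ)
    (hcons : opComm L (Hcompass L Jx Jy) (Qop L q) = 0) (τ : PSpec L) :
    ∑ u, ((Jx : ℂ) * (q (specMul τ (sigXX L u)) * commTrace τ (sigXX L u)) +
      (Jy : ℂ) * (q (specMul τ (sigYY L u)) * commTrace τ (sigYY L u))) = 0 := by
  have h : Matrix.trace (opComm L (Qop L q) (PauliOp L τ) * Hcompass L Jx Jy) = 0 := by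
    have h0 : Matrix.trace (PauliOp L τ * opComm L (Hcompass L Jx Jy) (Qop L q)) = 0 := by
      rw [hcons, Matrix.mul_zero, Matrix.trace_zero]
    rw [opComm, Matrix.mul_sub, Matrix.trace_sub, ← Matrix.mul_assoc, ← Matrix.mul_assoc,
      Matrix.trace_mul_cycle] at h0
    rwa [opComm, Matrix.sub_mul, Matrix.trace_sub]
  rw [Hcompass, Matrix.mul_neg, Matrix.trace_neg, neg_eq_zero, Finset.mul_sum,
    Matrix.trace_sum] at h
  simpa only [Matrix.mul_add, Matrix.mul_smul, Matrix.trace_add, Matrix.trace_smul,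
    smul_eq_mul, trace_Qop_opComm] using h

/-- The direction of the bond carrying the letter `p`: `e_x` for `X` and `e_y` otherwise. -/
def bondStep (L : ℕ) (p : Fin 4) : Site L := if p = 1 then (1, 0) else (0, 1)

/-- The Pauli product with the letter `p` at both ends of a bond. -/
def bond (L : ℕ) (p : Fin 4) (u : Site L) : PSpec L :=
  fun v => if v = u then p else if v = u + bondStep L p then p else 0

theorem sigXX_eq_bond (L : ℕ) : sigXX L = bond L 1 := rfl

theorem sigYY_eq_bond (L : ℕ) : sigYY L = bond L 2 := rfl

/-- The number of the antidiagonal containing a site. -/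
def antidiag {L : ℕ} (v : Site L) : ZMod L := v.1 + v.2

theorem antidiag_add_bondStep (L : ℕ) (p : Fin 4) (u : Site L) :
    antidiag (u + bondStep L p) = antidiag u + 1 := by
  unfold antidiag bondStep
  split_ifs <;> simp <;> ring

theorem natCast_add_inj {L : ℕ} {c : ZMod L} {a b : ℕ} (ha : a < L) (hb : b < L)
    (h : c + a = c + b) : a = b := by
  have h' := (ZMod.natCast_eq_natCast_iff' a b L).mp (add_left_cancel h)
  rwa [Nat.mod_eq_of_lt ha, Nat.mod_eq_of_lt hb] at h'

/-- A Pauli product meeting more than `k` antidiagonals has diagonal length more than `k`. -/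
theorem lt_Diag_of_card {L : ℕ} [NeZero L] {ρ : PSpec L} {k : ℕ} (c : ZMod L) (S : Finset ℕ)
    (hS : ∀ i ∈ S, i < L) (hcard : k < S.card)
    (hρ : ∀ i ∈ S, ∃ v, ρ v ≠ 0 ∧ antidiag v = c + i) : k < Diag L ρ := by
  have hne : {k | ∃ a : ZMod L, DiagBoundAt L ρ a k}.Nonempty :=
    ⟨L, 0, fun u _ => ZMod.val_lt _⟩
  obtain ⟨a, ha⟩ : ∃ a : ZMod L, DiagBoundAt L ρ a (Diag L ρ) := Nat.sInf_mem hne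
  refine hcard.trans_le ?_
  rw [← Finset.card_range (Diag L ρ)]
  refine Finset.card_le_card_of_injOn (fun i => (c + (i : ZMod L) - a).val) ?_ ?_
  · intro i hi
    obtain ⟨v, hv, hvi⟩ := hρ i hi
    have := ha v hv
    simpa [antidiag, ← hvi] using this
  · intro i hi i' hi' h
    exact natCast_add_inj (hS i hi) (hS i' hi') (sub_left_injective (ZMod.val_injective L h))

/-- The letter `p` at `x 0` and `x k`, and `Z` at the sites between them. -/
def chain (L : ℕ) (x : ℕ → Site L) (k : ℕ) (p : Fin 4) : PSpec L := fun v =>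
  if v = x 0 then p
  else if v = x k then p
  else if v ∈ (Finset.Ioo 0 k).image x then 3
  else 0

section Chain

variable {L : ℕ} {x : ℕ → Site L} {c : ZMod L} {k : ℕ} {p : Fin 4}

theorem path_inj (hx : ∀ i, antidiag (x i) = c + i) {i i' : ℕ} (hi : i < L) (hi' : i' < L) :
    x i = x i' ↔ i = i' :=
  ⟨fun h => natCast_add_inj hi hi' (by rw [← hx, ← hx, h]), fun h => by rw [h]⟩

theorem chain_zero : chain L x k p (x 0) = p := by simp [chain]

theorem chain_last : chain L x k p (x k) = p := by simp [chain]

theorem chain_interior (hx : ∀ i, antidiag (x i) = c + i) (hkL : k < L) {i : ℕ} (h0 : 0 < i)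
    (hik : i < k) : chain L x k p (x i) = 3 := by
  have h1 : x i ≠ x 0 := by rw [Ne, path_inj hx (by omega) (by omega)]; omega
  have h2 : x i ≠ x k := by rw [Ne, path_inj hx (by omega) (by omega)]; omega
  rw [chain, if_neg h1, if_neg h2,
    if_pos (Finset.mem_image_of_mem x (Finset.mem_Ioo.mpr ⟨h0, hik⟩))]

theorem chain_off {v : Site L} (hv : ∀ i ≤ k, v ≠ x i) : chain L x k p v = 0 := by
  rw [chain, if_neg (hv 0 (Nat.zero_le k)), if_neg (hv k le_rfl), if_neg]
  intro h
  obtain ⟨i, hi, rfl⟩ := Finset.mem_image.mp h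
  exact hv i (Finset.mem_Ioo.mp hi).2.le rfl

theorem bond_ne_zero {p' : Fin 4} {u v : Site L} (h : bond L p' u v ≠ 0) :
    bond L p' u v = p' ∧ (v = u ∨ v = u + bondStep L p') := by
  unfold bond at h ⊢
  split_ifs at h ⊢ <;> simp_all

theorem bond_mem (p' : Fin 4) (u v : Site L) : bond L p' u v = 0 ∨ bond L p' u v = p' := by
  unfold bond
  split_ifs <;> simp

theorem xor_ne_zero_iff (a b : Fin 4) : a ^^^ b ≠ 0 ↔ a ≠ b := by
  revert a b; decide

/-- The only bonds whose product with a chain has a smaller diagonal length are those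
at its two ends. -/
theorem bond_eq_of_Diag_le [NeZero L] (hx : ∀ i, antidiag (x i) = c + i) (hk : 1 ≤ k)
    (hkL : k + 2 < L) (hp : p ≠ 0) (hlast : x k = x (k - 1) + bondStep L p)
    {p' : Fin 4} (hp' : p' ≠ 3) {u : Site L}
    (hD : Diag L (specMul (chain L x k p) (bond L p' u)) ≤ k) :
    p' = p ∧ (u = x 0 ∨ u = x (k - 1)) := by
  have hint : ∀ i, 0 < i → i < k → specMul (chain L x k p) (bond L p' u) (x i) ≠ 0 := by
    intro i h0 hi
    rw [specMul, xor_ne_zero_iff, chain_interior hx (by omega) h0 hi]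
    rcases bond_mem p' u (x i) with h | h <;> rw [h]
    · decide
    · exact hp'.symm
  by_cases h0 : bond L p' u (x 0) = p
  · obtain ⟨hpp, hu⟩ := bond_ne_zero (by rw [h0]; exact hp)
    have hpp : p' = p := hpp.symm.trans h0
    subst hpp
    refine ⟨rfl, Or.inl ?_⟩
    by_contra hne
    have hu : x 0 = u + bondStep L p' := hu.resolve_left (Ne.symm hne)
    have hau : antidiag u = c - 1 := by
      have h := antidiag_add_bondStep L p' u
      rw [← hu, hx 0] at h
      rw [Nat.cast_zero, add_zero] at h
      rw [h]; ring
    have hoff : ∀ i ≤ k, u ≠ x i := by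
      intro i hi h
      have h1 : (c - 1) + ((0 : ℕ) : ZMod L) = (c - 1) + ((i + 1 : ℕ) : ZMod L) := by
        have h2 : c - 1 = c + i := by rw [← hau, h, hx]
        push_cast
        linear_combination h2
      have := natCast_add_inj (by omega) (by omega) h1
      omega
    have hxk : bond L p' u (x k) = 0 := by
      rw [bond, if_neg (Ne.symm (hoff k le_rfl)), if_neg]
      rw [← hu, path_inj hx (by omega) (by omega)]
      omega
    refine absurd hD (not_le.mpr (lt_Diag_of_card (c - 1)
      (insert 0 (Finset.Icc 2 (k + 1))) ?_ ?_ ?_))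
    · intro i hi
      simp only [Finset.mem_insert, Finset.mem_Icc] at hi
      omega
    · rw [Finset.card_insert_of_notMem (by simp), Nat.card_Icc]
      omega
    · intro i hi
      rcases Finset.mem_insert.mp hi with rfl | hi
      · refine ⟨u, ?_, by rw [hau]; simp⟩
        rw [specMul, xor_ne_zero_iff, chain_off hoff]
        simpa [bond] using hp.symm
      · obtain ⟨h2, hi⟩ := Finset.mem_Icc.mp hi
        obtain ⟨i, rfl⟩ : ∃ j, i = j + 1 := ⟨i - 1, by omega⟩
        refine ⟨x i, ?_, by rw [hx]; push_cast; ring⟩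
        rcases Nat.lt_or_eq_of_le (Nat.le_of_succ_le_succ hi) with h | rfl
        · exact hint i (by omega) h
        · rw [specMul, xor_ne_zero_iff, chain_last, hxk]
          exact hp
  have hρ0 : specMul (chain L x k p) (bond L p' u) (x 0) ≠ 0 := by
    rw [specMul, xor_ne_zero_iff, chain_zero]
    exact Ne.symm h0
  have hρi : ∀ i < k, specMul (chain L x k p) (bond L p' u) (x i) ≠ 0 := by
    intro i hi
    rcases Nat.eq_zero_or_pos i with rfl | h
    · exact hρ0
    · exact hint i h hi
  by_cases h1 : bond L p' u (x k) = p
  · obtain ⟨hpp, hu⟩ := bond_ne_zero (by rw [h1]; exact hp)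
    have hpp : p' = p := hpp.symm.trans h1
    subst hpp
    refine ⟨rfl, Or.inr ?_⟩
    rcases hu with hu | hu
    · have hau : antidiag (u + bondStep L p') = c + (k + 1 : ℕ) := by
        rw [antidiag_add_bondStep, ← hu, hx]
        push_cast; ring
      have hoff : ∀ i ≤ k, u + bondStep L p' ≠ x i := by
        intro i hi h
        rw [h, hx] at hau
        have := natCast_add_inj (by omega) (by omega) hau
        omega
      refine absurd hD (not_le.mpr (lt_Diag_of_card c (insert (k + 1) (Finset.range k)) ?_ ?_ ?_))
      · intro i hi
        simp only [Finset.mem_insert, Finset.mem_range] at hi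
        omega
      · rw [Finset.card_insert_of_notMem (by simp), Finset.card_range]
        omega
      · intro i hi
        rcases Finset.mem_insert.mp hi with rfl | hi
        · refine ⟨u + bondStep L p', ?_, hau⟩
          rw [specMul, xor_ne_zero_iff, chain_off hoff]
          simpa [bond] using hp.symm
        · exact ⟨x i, hρi i (Finset.mem_range.mp hi), hx i⟩
    · rw [hlast] at hu
      exact (add_right_cancel hu).symm
  · refine absurd hD (not_le.mpr (lt_Diag_of_card c (Finset.range (k + 1)) ?_ ?_ ?_))
    · intro i hi
      have := Finset.mem_range.mp hi
      omega
    · rw [Finset.card_range]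
      omega
    · intro i hi
      refine ⟨x i, ?_, hx i⟩
      rcases Nat.lt_or_eq_of_le (Nat.le_of_lt_succ (Finset.mem_range.mp hi)) with h | rfl
      · exact hρi i h
      · rw [specMul, xor_ne_zero_iff, chain_last]
        exact Ne.symm h1

theorem prod_pauliTrace_eq [NeZero L] {f : Site L → ℂ} {m : Site L} {w : ℂ} (hm : f m = w)
    (hf : ∀ v, v ≠ m → f v = 2) : ∏ v, f v = 2 ^ Fintype.card (Site L) * (w / 2) := by
  have h : ∀ v, f v = 2 * if v = m then w / 2 else 1 := by
    intro v
    split_ifs with hv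
    · rw [hv, hm]; ring
    · rw [hf v hv, mul_one]
  simp_rw [h]
  rw [Finset.prod_mul_distrib, Finset.prod_const, Finset.prod_ite_eq' Finset.univ m,
    if_pos (Finset.mem_univ m), Finset.card_univ]

theorem commTrace_eq [NeZero L] {τ ρ : PSpec L} {m : Site L} (hτ : τ m = 3) (hρ : ρ m = p)
    (h : ∀ v, v ≠ m → ρ v = 0 ∨ τ v = ρ v) :
    commTrace τ ρ = 2 ^ Fintype.card (Site L) * (pauliTrace 3 p (3 ^^^ p) / 2) -
      2 ^ Fintype.card (Site L) * (pauliTrace p 3 (3 ^^^ p) / 2) := by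
  unfold commTrace
  rw [prod_pauliTrace_eq (m := m) (w := pauliTrace 3 p (3 ^^^ p)) (by rw [hτ, hρ]),
    prod_pauliTrace_eq (m := m) (w := pauliTrace p 3 (3 ^^^ p)) (by rw [hτ, hρ])]
  · intro v hv
    rw [xor_comm_fin]
    exact pauliTrace_of_trivial _ _ ((h v hv).imp id fun h => Or.inr h.symm)
  · intro v hv
    exact pauliTrace_of_trivial _ _ (Or.inr (h v hv))

theorem pauliTrace_Z_sub_ne_zero (hp : p = 1 ∨ p = 2) :
    pauliTrace 3 p (3 ^^^ p) - pauliTrace p 3 (3 ^^^ p) ≠ 0 := by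
  rcases hp with rfl | rfl
  · have h : (3 : Fin 4) ^^^ 1 = 2 := by decide
    simp [h, pauliTrace, pauli, Matrix.trace_fin_two, Complex.ext_iff]
    norm_num
  · have h : (3 : Fin 4) ^^^ 2 = 1 := by decide
    simp [h, pauliTrace, pauli, Matrix.trace_fin_two, Complex.ext_iff]
    norm_num

theorem bond_left (p : Fin 4) (u : Site L) : bond L p u u = p := by simp [bond]

theorem bond_right (p : Fin 4) (u : Site L) : bond L p u (u + bondStep L p) = p := by
  unfold bond
  split_ifs <;> simp_all

theorem commTrace_first [NeZero L] (hx : ∀ i, antidiag (x i) = c + i) (hk : 2 ≤ k)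
    (hkL : k < L) (hfirst : x 1 = x 0 + bondStep L p) :
    commTrace (chain L x k p) (bond L p (x 0)) =
      2 ^ Fintype.card (Site L) * (pauliTrace 3 p (3 ^^^ p) / 2) -
      2 ^ Fintype.card (Site L) * (pauliTrace p 3 (3 ^^^ p) / 2) := by
  refine commTrace_eq (m := x 1) (chain_interior hx hkL one_pos (by omega))
    (hfirst ▸ bond_right p (x 0)) fun v hv => ?_
  by_cases h : bond L p (x 0) v = 0
  · exact Or.inl h
  · obtain rfl := (bond_ne_zero h).2.resolve_right (hfirst ▸ hv)
    exact Or.inr (by rw [chain_zero, bond_left])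

theorem commTrace_last [NeZero L] (hx : ∀ i, antidiag (x i) = c + i) (hk : 2 ≤ k)
    (hkL : k < L) (hlast : x k = x (k - 1) + bondStep L p) :
    commTrace (chain L x k p) (bond L p (x (k - 1))) =
      2 ^ Fintype.card (Site L) * (pauliTrace 3 p (3 ^^^ p) / 2) -
      2 ^ Fintype.card (Site L) * (pauliTrace p 3 (3 ^^^ p) / 2) := by
  refine commTrace_eq (m := x (k - 1)) (chain_interior hx hkL (by omega) (by omega))
    (bond_left p _) fun v hv => ?_
  by_cases h : bond L p (x (k - 1)) v = 0
  · exact Or.inl h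
  · obtain h' := (bond_ne_zero h).2.resolve_left hv
    rw [h', bond_right, ← hlast, chain_last]
    exact Or.inr rfl

/-- The two truncations of a chain have opposite coefficients. -/
theorem coeff_truncate_chain [NeZero L] (hx : ∀ i, antidiag (x i) = c + i) (hk : 2 ≤ k)
    (hkL : k + 2 < L) (hp : p = 1 ∨ p = 2) (hfirst : x 1 = x 0 + bondStep L p)
    (hlast : x k = x (k - 1) + bondStep L p) {Jx Jy : ℝ} (hJx : Jx ≠ 0) (hJy : Jy ≠ 0)
    {q : PSpec L → ℂ} (hsupp : ∀ σ : PSpec L, q σ ≠ 0 → σ ≠ 0 ∧ Diag L σ ≤ k)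
    (hcons : opComm L (Hcompass L Jx Jy) (Qop L q) = 0) :
    q (specMul (chain L x k p) (bond L p (x 0))) =
      - q (specMul (chain L x k p) (bond L p (x (k - 1)))) := by
  set τ := chain L x k p with hτ
  have hzero : ∀ p', p' ≠ 3 → ∀ u, ¬ (p' = p ∧ (u = x 0 ∨ u = x (k - 1))) →
      q (specMul τ (bond L p' u)) * commTrace τ (bond L p' u) = 0 := by
    intro p' hp' u h
    by_contra hne
    refine h (bond_eq_of_Diag_le hx (by omega) hkL ?_ hlast hp'
      (hsupp _ (left_ne_zero_of_mul hne)).2)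
    rcases hp with rfl | rfl <;> decide
  have hsum := sum_coeff_eq_zero L Jx Jy q hcons τ
  rw [sigXX_eq_bond, sigYY_eq_bond, Finset.sum_add_distrib, ← Finset.mul_sum,
    ← Finset.mul_sum] at hsum
  have hself : ∑ u, q (specMul τ (bond L p u)) * commTrace τ (bond L p u) = 0 := by
    rcases hp with rfl | rfl
    · rw [Finset.sum_eq_zero (f := fun u => q (specMul τ (bond L 2 u)) * commTrace τ (bond L 2 u))
        fun u _ => hzero 2 (by decide) u fun h => absurd h.1 (by decide), mul_zero, add_zero] at hsum
      exact (mul_eq_zero.mp hsum).resolve_left (by exact_mod_cast hJx)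
    · rw [Finset.sum_eq_zero (f := fun u => q (specMul τ (bond L 1 u)) * commTrace τ (bond L 1 u))
        fun u _ => hzero 1 (by decide) u fun h => absurd h.1 (by decide), mul_zero, zero_add] at hsum
      exact (mul_eq_zero.mp hsum).resolve_left (by exact_mod_cast hJy)
  have hne : x 0 ≠ x (k - 1) := by
    rw [Ne, path_inj hx (by omega) (by omega)]
    omega
  rw [Fintype.sum_eq_add (x 0) (x (k - 1)) hne fun u hu =>
    hzero p (by rcases hp with rfl | rfl <;> decide) u fun h => h.2.elim hu.1 hu.2,
    commTrace_first hx hk (by omega) hfirst, commTrace_last hx hk (by omega) hlast,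
    ← add_mul, ← mul_sub, ← sub_div] at hself
  have hw := pauliTrace_Z_sub_ne_zero hp
  refine eq_neg_of_add_eq_zero_left ((mul_eq_zero.mp hself).resolve_right ?_)
  exact mul_ne_zero (pow_ne_zero _ two_ne_zero) (div_ne_zero hw two_ne_zero)

end Chain

theorem stair_antidiag (L : ℕ) (u1 : Site L) (i : ℕ) :
    antidiag (stair L u1 i) = antidiag u1 - 1 + i := by
  unfold antidiag stair
  rcases Nat.even_or_odd' i with ⟨m, rfl | rfl⟩
  · have h1 : 2 * m % 2 = 0 := by omega
    have h2 : 2 * m / 2 = m := by omega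
    simp [h1, h2]; ring
  · have h1 : (2 * m + 1) % 2 = 1 := by omega
    simp [h1]; ring

theorem stair_succ (L : ℕ) (u1 : Site L) (i : ℕ) :
    stair L u1 (i + 1) = stair L u1 i + bondStep L (endL i) := by
  unfold stair bondStep endL
  rcases Nat.even_or_odd' i with ⟨m, rfl | rfl⟩
  · have h1 : 2 * m % 2 = 0 := by omega
    have h3 : (2 * m + 1) % 2 = 1 := by omega
    simp [h1, h3]
  · have h1 : (2 * m + 1) % 2 = 1 := by omega
    have h3 : (2 * m + 1 + 1) % 2 = 0 := by omega
    have h4 : (2 * m + 1 + 1) / 2 = m + 1 := by omega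
    simp [h1, h3, h4]
    ext <;> simp <;> ring

theorem stair_inj {L : ℕ} (u1 : Site L) (j : ℕ) {i i' : ℕ} (hi : i < L) (hi' : i' < L) :
    stair L u1 (j + i) = stair L u1 (j + i') ↔ i = i' :=
  path_inj (x := fun i => stair L u1 (j + i)) (c := antidiag u1 - 1 + j)
    (fun i => by rw [stair_antidiag]; push_cast; ring) hi hi'

theorem Cspec_first (L k j : ℕ) (u1 : Site L) : Cspec L k j u1 (stair L u1 j) = endL j := by
  simp [Cspec]

theorem Cspec_last {L k : ℕ} (j : ℕ) (hk : 2 ≤ k) (hkL : k < L) (u1 : Site L) :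
    Cspec L k j u1 (stair L u1 (j + (k - 1))) = endR k j := by
  have h : stair L u1 (j + (k - 1)) ≠ stair L u1 j := by
    rw [Ne, ← Nat.add_zero j, Nat.add_assoc, Nat.zero_add, stair_inj u1 j (by omega) (by omega)]
    omega
  rw [Cspec, if_neg h, if_pos (by rw [← Nat.add_sub_assoc (by omega)])]

theorem Cspec_interior {L k : ℕ} (j : ℕ) {i : ℕ} (h0 : 0 < i) (hi : i < k - 1) (hkL : k < L)
    (u1 : Site L) : Cspec L k j u1 (stair L u1 (j + i)) = 3 := by
  have h1 : stair L u1 (j + i) ≠ stair L u1 j := by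
    rw [Ne, ← Nat.add_zero j, Nat.add_assoc, Nat.zero_add, stair_inj u1 j (by omega) (by omega)]
    omega
  have h2 : stair L u1 (j + i) ≠ stair L u1 (j + k - 1) := by
    rw [Nat.add_sub_assoc (by omega), Ne, stair_inj u1 j (by omega) (by omega)]
    omega
  rw [Cspec, if_neg h1, if_neg h2, if_pos]
  exact Finset.mem_image_of_mem _ (Finset.mem_Icc.mpr ⟨by omega, by omega⟩)

theorem Cspec_off {L k : ℕ} (j : ℕ) (hk : 1 ≤ k) {u1 v : Site L}
    (hv : ∀ i < k, v ≠ stair L u1 (j + i)) : Cspec L k j u1 v = 0 := by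
  have h0 : v ≠ stair L u1 j := hv 0 hk
  rw [Cspec, if_neg h0, if_neg, if_neg]
  · intro h
    obtain ⟨i, hi, rfl⟩ := Finset.mem_image.mp h
    have hi := Finset.mem_Icc.mp hi
    exact hv (i - j) (by omega) (by congr 1; omega)
  · rw [Nat.add_sub_assoc hk]
    exact hv (k - 1) (by omega)

theorem endL_eq_or (j : ℕ) : endL j = 1 ∨ endL j = 2 := by
  unfold endL
  split_ifs <;> simp

theorem endL_succ (j : ℕ) : endL (j + 1) = 3 ^^^ endL j := by
  rcases Nat.mod_two_eq_zero_or_one j with h | h <;> simp [endL, Nat.add_mod, h]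

theorem endL_add_even (j : ℕ) {m : ℕ} (hm : m % 2 = 0) : endL (j + m) = endL j := by
  simp [endL, Nat.add_mod, hm]

theorem endR_odd (j : ℕ) {k : ℕ} (hodd : k % 2 = 1) : endR k j = 3 ^^^ endL j := by
  rcases Nat.mod_two_eq_zero_or_one j with h | h <;> simp [endR, endL, hodd, h]

theorem bond_stair {L : ℕ} {u1 : Site L} {j m i : ℕ} {p : Fin 4} (hp : endL (j + m) = p)
    (hm : m + 1 < L) (hi : i < L) :
    bond L p (stair L u1 (j + m)) (stair L u1 (j + i)) =
      if i = m ∨ i = m + 1 then p else 0 := by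
  have h0 := stair_inj u1 j hi (by omega : m < L)
  have h1 := stair_inj u1 j hi hm
  rw [bond, ← hp, ← stair_succ, Nat.add_assoc]
  split_ifs <;> simp_all

theorem bond_stair_off {L : ℕ} {u1 v : Site L} {j m : ℕ} {p : Fin 4} (hp : endL (j + m) = p)
    (h0 : v ≠ stair L u1 (j + m)) (h1 : v ≠ stair L u1 (j + (m + 1))) :
    bond L p (stair L u1 (j + m)) v = 0 := by
  rw [bond, ← hp, ← stair_succ, Nat.add_assoc, if_neg h0, if_neg h1]

section Truncation

variable {L : ℕ} (u1 : Site L) (j : ℕ) {k : ℕ}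

theorem stair_shift_antidiag (i : ℕ) :
    antidiag (stair L u1 (j + i)) = antidiag u1 - 1 + j + i := by
  rw [stair_antidiag]
  push_cast
  ring

theorem truncate_first (hodd : k % 2 = 1) (hk : 3 ≤ k) (hkL : k + 2 < L) :
    specMul (chain L (fun i => stair L u1 (j + i)) k (endL j))
      (bond L (endL j) (stair L u1 (j + 0))) = Cspec L k (j + 1) u1 := by
  funext v
  have hb := fun i hi => bond_stair (L := L) (u1 := u1) (j := j) (m := 0) (i := i) rfl
    (by omega) hi
  rw [specMul]
  by_cases hv : ∃ i ≤ k, v = stair L u1 (j + i)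
  · obtain ⟨i, hi, rfl⟩ := hv
    have hb := hb i (by omega)
    simp only [Nat.add_zero] at hb ⊢
    rw [hb]
    rcases Nat.eq_zero_or_pos i with rfl | h0
    · rw [Cspec_off _ (by omega) fun i hi => ?_,
        chain_zero (x := fun i => stair L u1 (j + i))]
      · simp
      · rw [Nat.add_assoc, Ne, stair_inj u1 j (by omega) (by omega)]
        omega
    rcases Nat.lt_or_eq_of_le hi with hik | rfl
    · rw [chain_interior (stair_shift_antidiag u1 j) (by omega) h0 hik]
      rcases Nat.lt_or_eq_of_le h0 with h1 | rfl
      · obtain ⟨i, rfl⟩ : ∃ m, i = 1 + m := ⟨i - 1, by omega⟩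
        rw [← Nat.add_assoc, Cspec_interior _ (by omega) (by omega) (by omega), if_neg (by omega)]
        decide
      · rw [Cspec_first, endL_succ, if_pos (Or.inr rfl)]
    · have h := Cspec_last (j + 1) (by omega : 2 ≤ i) (by omega) u1
      rw [show j + 1 + (i - 1) = j + i by omega] at h
      rw [h, chain_last (x := fun i => stair L u1 (j + i)), if_neg (by omega), endR_odd _ hodd,
        endL_succ]
      generalize endL j = p
      revert p
      decide
  · push Not at hv
    rw [chain_off hv, bond_stair_off (m := 0) (p := endL j) rfl (hv 0 (by omega)) (hv 1 (by omega)),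
      Cspec_off _ (by omega) fun i hi => by rw [Nat.add_assoc]; exact hv _ (by omega)]
    rfl

theorem truncate_last (hodd : k % 2 = 1) (hk : 3 ≤ k) (hkL : k + 2 < L) :
    specMul (chain L (fun i => stair L u1 (j + i)) k (endL j))
      (bond L (endL j) (stair L u1 (j + (k - 1)))) = Cspec L k j u1 := by
  have hp : endL (j + (k - 1)) = endL j := endL_add_even j (by omega)
  funext v
  rw [specMul]
  by_cases hv : ∃ i ≤ k, v = stair L u1 (j + i)
  · obtain ⟨i, hi, rfl⟩ := hv
    rw [bond_stair hp (by omega) (by omega)]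
    rcases Nat.eq_zero_or_pos i with rfl | h0
    · rw [chain_zero (x := fun i => stair L u1 (j + i)), if_neg (by omega), Nat.add_zero,
        Cspec_first]
      generalize endL j = p
      revert p
      decide
    rcases Nat.lt_or_eq_of_le hi with hik | rfl
    · rw [chain_interior (stair_shift_antidiag u1 j) (by omega) h0 hik]
      rcases Nat.lt_or_eq_of_le (Nat.le_sub_one_of_lt hik) with h1 | rfl
      · rw [Cspec_interior _ h0 h1 (by omega), if_neg (by omega)]
        decide
      · rw [Cspec_last _ (by omega) (by omega), if_pos (Or.inl rfl), endR_odd _ hodd]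
    · rw [chain_last (x := fun i => stair L u1 (j + i)), if_pos (by omega),
        Cspec_off _ (by omega) fun m hm => ?_]
      · generalize endL j = p
        revert p
        decide
      · rw [Ne, stair_inj u1 j (by omega) (by omega)]
        omega
  · push Not at hv
    rw [chain_off hv, bond_stair_off hp (hv _ (by omega)) (hv _ (by omega)),
      Cspec_off _ (by omega) fun i hi => hv _ (by omega)]
    rfl

/-- Consecutive standard-form products have opposite coefficients. -/
theorem coeff_Cspec_succ [NeZero L] {Jx Jy : ℝ} (hJx : Jx ≠ 0) (hJy : Jy ≠ 0)
    (hodd : k % 2 = 1) (hk : 3 ≤ k) (hkL : k + 2 < L) {q : PSpec L → ℂ}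
    (hsupp : ∀ σ : PSpec L, q σ ≠ 0 → σ ≠ 0 ∧ Diag L σ ≤ k)
    (hcons : opComm L (Hcompass L Jx Jy) (Qop L q) = 0) :
    q (Cspec L k (j + 1) u1) = - q (Cspec L k j u1) := by
  rw [← truncate_first u1 j hodd hk hkL, ← truncate_last u1 j hodd hk hkL]
  refine coeff_truncate_chain (x := fun i => stair L u1 (j + i)) (stair_shift_antidiag u1 j)
    (by omega) hkL (endL_eq_or j) (stair_succ L u1 j) ?_ hJx hJy hsupp hcons
  have h := stair_succ L u1 (j + (k - 1))
  rwa [endL_add_even j (by omega), Nat.add_assoc, Nat.sub_add_cancel (by omega)] at h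

end Truncation

/-- For odd `k̄` with `3 ≤ k̄ ≤ L/2`, the coefficients of the
standard-form products in a local conserved quantity alternate in sign:
`q_{C^k̄_j} = q_{C^k̄_1}` for odd `j` and `q_{C^k̄_j} = −q_{C^k̄_1}` for even `j`. -/
theorem standard_form_coefficients_alternate_odd_k
    (L : ℕ) [NeZero L] (Jx Jy : ℝ) (hJx : Jx ≠ 0) (hJy : Jy ≠ 0)
    (k : ℕ) (hodd : k % 2 = 1) (hk : 3 ≤ k) (hkL : 2 * k ≤ L)
    (q : PSpec L → ℂ)
    (hsupp : ∀ σ : PSpec L, q σ ≠ 0 → σ ≠ 0 ∧ Diag L σ ≤ k)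
    (hcons : opComm L (Hcompass L Jx Jy) (Qop L q) = 0)
    (u1 : Site L) (j : ℕ) (hj : 1 ≤ j) :
    (j % 2 = 1 → q (Cspec L k j u1) = q (Cspec L k 1 u1)) ∧
    (j % 2 = 0 → q (Cspec L k j u1) = - q (Cspec L k 1 u1)) := by
  have hsucc : ∀ j, q (Cspec L k (j + 1) u1) = - q (Cspec L k j u1) := fun j =>
    coeff_Cspec_succ u1 j hJx hJy hodd hk (by omega) hsupp hcons
  have hpow : ∀ n, q (Cspec L k (n + 1) u1) = (-1) ^ n * q (Cspec L k 1 u1) := by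
    intro n
    induction n with
    | zero => simp
    | succ n ih => rw [hsucc, ih, pow_succ]; ring
  obtain ⟨n, rfl⟩ : ∃ n, j = n + 1 := ⟨j - 1, by omega⟩
  refine ⟨fun h => ?_, fun h => ?_⟩
  · rw [hpow, Even.neg_one_pow (Nat.even_iff.mpr (by omega)), one_mul]
  · rw [hpow, Odd.neg_one_pow (Nat.odd_iff.mpr (by omega)), neg_one_mul]
end

section
/- Let k̄ be even with 4 ≤ k̄ ≤ L/2 and let Q = Σ_{A∈P_Λ, Diag A ≤ k̄} q_A A satisfy [H,Q] = 0. Then for each base site u_1 the coefficients of the standard-form products satisfy q_{C^{k̄}_j} = q_{C^{k̄}_1} for odd j and q_{C^{k̄}_j} = κ · q_{C^{k̄}_1} for even j, where κ = J_x/J_y. -/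
open Complex Matrix

/-- The phase of the product of two Pauli matrices. -/
noncomputable def pauliPhase (a b : Fin 4) : ℂ :=
  if (a = 1 ∧ b = 2) ∨ (a = 2 ∧ b = 3) ∨ (a = 3 ∧ b = 1) then Complex.I
  else if (a = 2 ∧ b = 1) ∨ (a = 3 ∧ b = 2) ∨ (a = 1 ∧ b = 3) then -Complex.I
  else 1

theorem pauli_mul_pauli (a b : Fin 4) :
    pauli a * pauli b = pauliPhase a b • pauli (a ^^^ b) := by
  fin_cases a <;> fin_cases b <;> ext i j <;> fin_cases i <;> fin_cases j <;>
    simp [pauli, pauliPhase, Matrix.mul_apply, Fin.sum_univ_two]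

theorem trace_pauli (a : Fin 4) : Matrix.trace (pauli a) = if a = 0 then 2 else 0 := by
  fin_cases a <;> simp [pauli, Matrix.trace_fin_two]

theorem pauliPhase_self (a : Fin 4) : pauliPhase a a = 1 := by
  fin_cases a <;> simp [pauliPhase]

theorem fin4_xor_eq_zero_iff (a b : Fin 4) : a ^^^ b = 0 ↔ a = b := by
  revert a b; decide

theorem PauliOp_mul (L : ℕ) [NeZero L] (σ τ : PSpec L) :
    PauliOp L σ * PauliOp L τ
      = (∏ u, pauliPhase (σ u) (τ u)) • PauliOp L (specMul σ τ) := by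
  ext s t
  have h : ∀ u, (pauliPhase (σ u) (τ u)) * pauli (specMul σ τ u) (s u) (t u)
      = ∑ x : Fin 2, pauli (σ u) (s u) x * pauli (τ u) x (t u) := by
    intro u
    have := congrFun (congrFun (pauli_mul_pauli (σ u) (τ u)) (s u)) (t u)
    rw [Matrix.mul_apply] at this
    rw [this]; rfl
  simp only [Matrix.mul_apply, PauliOp, Matrix.smul_apply, smul_eq_mul]
  rw [← Finset.prod_mul_distrib, Finset.prod_congr rfl (fun u _ => h u),
    Finset.prod_univ_sum, Fintype.piFinset_univ]
  simp [Finset.prod_mul_distrib]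

theorem trace_PauliOp (L : ℕ) [NeZero L] (σ : PSpec L) :
    Matrix.trace (PauliOp L σ) = ∏ u, Matrix.trace (pauli (σ u)) := by
  simp only [Matrix.trace, Matrix.diag_apply, PauliOp]
  rw [Finset.prod_univ_sum, Fintype.piFinset_univ]

theorem trace_PauliOp_mul_s12 (L : ℕ) [NeZero L] (σ τ : PSpec L) :
    Matrix.trace (PauliOp L σ * PauliOp L τ)
      = if τ = σ then 2 ^ Fintype.card (Site L) else 0 := by
  rw [PauliOp_mul, Matrix.trace_smul, trace_PauliOp]
  split_ifs with h
  · subst h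
    simp [pauliPhase_self, trace_pauli, specMul]
  · obtain ⟨u, hu⟩ := Function.ne_iff.mp h
    rw [smul_eq_mul, Finset.prod_eq_zero (i := u) (s := Finset.univ)
      (f := fun u => (pauli (specMul σ τ u)).trace) (Finset.mem_univ u), mul_zero]
    rw [trace_pauli, if_neg]
    rw [specMul, fin4_xor_eq_zero_iff]
    exact fun e => hu e.symm

/-- The unit step along a bond: `e_x` for `false`, `e_y` for `true`. -/
def bondDir (L : ℕ) (d : Bool) : Site L := if d then (0, 1) else (1, 0)

/-- The Pauli letter of a bond: `X` for `false`, `Y` for `true`. -/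
def bondLetter (d : Bool) : Fin 4 := if d then 2 else 1

/-- The product of Pauli matrices on a bond of the compass Hamiltonian. -/
def bondSpec (L : ℕ) (b : Bool × Site L) : PSpec L :=
  fun z => if z = b.2 ∨ z = b.2 + bondDir L b.1 then bondLetter b.1 else 0

/-- `σ` multiplied by a bond term, up to phase. -/
def toggle {L : ℕ} (b : Bool × Site L) (σ : PSpec L) : PSpec L := specMul (bondSpec L b) σ

/-- The sign with which `w ^^^ a` is sent to `a` under the commutator with the letter `w`. -/
def letterSign (w a : Fin 4) : ℤ :=
  if a = 0 ∨ a = w then 0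
  else if (w = 1 ∧ a = 3) ∨ (w = 2 ∧ a = 1) ∨ (w = 3 ∧ a = 2) then 1 else -1

/-- The sign of the commutator of a two-site term with both letters equal to `w`, the result
having letters `a` and `b` on these two sites. -/
def pairSign (w a b : Fin 4) : ℤ :=
  if b = 0 ∨ b = w then letterSign w a
  else if a = 0 ∨ a = w then letterSign w b else 0

/-- The sign with which the commutator of a bond term yields `σ`. -/
def bondSign {L : ℕ} (b : Bool × Site L) (σ : PSpec L) : ℤ :=
  pairSign (bondLetter b.1) (σ b.2) (σ (b.2 + bondDir L b.1))

theorem phase_sub_phase (d : Bool) (a b : Fin 4) :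
    pauliPhase (bondLetter d) (bondLetter d ^^^ a) * pauliPhase (bondLetter d) (bondLetter d ^^^ b)
      - pauliPhase (bondLetter d ^^^ a) (bondLetter d)
        * pauliPhase (bondLetter d ^^^ b) (bondLetter d)
      = 2 * Complex.I * (pairSign (bondLetter d) a b : ℂ) := by
  cases d <;> fin_cases a <;> fin_cases b <;>
    simp [pauliPhase, bondLetter, pairSign, letterSign] <;> ring

theorem bondSpec_false (L : ℕ) (u : Site L) : bondSpec L (false, u) = sigXX L u := by
  funext z
  by_cases h : z = u <;> simp [bondSpec, sigXX, bondDir, bondLetter, h]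

theorem bondSpec_true (L : ℕ) (u : Site L) : bondSpec L (true, u) = sigYY L u := by
  funext z
  by_cases h : z = u <;> simp [bondSpec, sigYY, bondDir, bondLetter, h]

theorem specMul_self_left {L : ℕ} (σ τ : PSpec L) : specMul σ (specMul σ τ) = τ := by
  funext u
  have : ∀ a b : Fin 4, a ^^^ (a ^^^ b) = b := by decide
  exact this _ _

theorem toggle_toggle_self {L : ℕ} (b : Bool × Site L) (σ : PSpec L) :
    toggle b (toggle b σ) = σ := specMul_self_left _ _

theorem toggle_comm {L : ℕ} (b c : Bool × Site L) (σ : PSpec L) :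
    toggle b (toggle c σ) = toggle c (toggle b σ) := by
  funext u
  have : ∀ a b c : Fin 4, a ^^^ (b ^^^ c) = b ^^^ (a ^^^ c) := by decide
  exact this _ _ _

theorem bondDir_ne_zero {L : ℕ} (hL : 1 < L) (d : Bool) : bondDir L d ≠ 0 := by
  have : Fact (1 < L) := ⟨hL⟩
  cases d <;> simp [bondDir, Prod.ext_iff]

theorem prod_pauliPhase_bond {L : ℕ} [NeZero L] (hL : 1 < L) (b : Bool × Site L) (σ : PSpec L) :
    (∏ u, pauliPhase (bondSpec L b u) (toggle b σ u))
      - (∏ u, pauliPhase (toggle b σ u) (bondSpec L b u))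
      = 2 * Complex.I * (bondSign b σ : ℂ) := by
  have hne : b.2 ≠ b.2 + bondDir L b.1 := by
    simpa using (bondDir_ne_zero hL b.1)
  have h1 : ∀ a, pauliPhase 0 a = 1 := by intro a; simp [pauliPhase]
  have h2 : ∀ a, pauliPhase a 0 = 1 := by intro a; simp [pauliPhase]
  have hz : ∀ u, u ∉ ({b.2, b.2 + bondDir L b.1} : Finset (Site L)) → bondSpec L b u = 0 := by
    intro u hu
    simp only [Finset.mem_insert, Finset.mem_singleton] at hu
    simp [bondSpec, hu]
  rw [← Finset.prod_subset (Finset.subset_univ {b.2, b.2 + bondDir L b.1})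
      (fun u _ hu => by rw [hz u hu, h1]),
    ← Finset.prod_subset (Finset.subset_univ {b.2, b.2 + bondDir L b.1})
      (fun u _ hu => by rw [hz u hu, h2]),
    Finset.prod_pair hne, Finset.prod_pair hne, bondSign, ← phase_sub_phase]
  simp [toggle, specMul, bondSpec]

/-- The compass coupling of a bond type. -/
def coupling (Jx Jy : ℝ) (d : Bool) : ℝ := if d then Jy else Jx

theorem trace_opComm_bond {L : ℕ} [NeZero L] (hL : 1 < L) (b : Bool × Site L) (σ τ : PSpec L) :
    Matrix.trace (PauliOp L τ * opComm L (PauliOp L (bondSpec L b)) (PauliOp L σ))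
      = if σ = toggle b τ then
          2 ^ Fintype.card (Site L) * (2 * Complex.I * (bondSign b τ : ℂ)) else 0 := by
  have hc : specMul σ (bondSpec L b) = specMul (bondSpec L b) σ := by
    funext u
    have : ∀ a b : Fin 4, a ^^^ b = b ^^^ a := by decide
    exact this _ _
  rw [opComm, PauliOp_mul, PauliOp_mul, hc, ← sub_smul, Matrix.mul_smul, Matrix.trace_smul,
    trace_PauliOp_mul_s12]
  have hiff : specMul (bondSpec L b) σ = τ ↔ σ = toggle b τ :=
    ⟨fun h => by rw [← h]; exact (specMul_self_left _ _).symm,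
      fun h => by rw [h]; exact specMul_self_left _ _⟩
  simp only [hiff]
  split_ifs with h
  · rw [h, prod_pauliPhase_bond hL, smul_eq_mul, mul_comm]
  · simp

theorem Hcompass_eq_sum_bonds (L : ℕ) [NeZero L] (Jx Jy : ℝ) :
    Hcompass L Jx Jy
      = - ∑ b : Bool × Site L, (coupling Jx Jy b.1 : ℂ) • PauliOp L (bondSpec L b) := by
  rw [Hcompass, Fintype.sum_prod_type (fun b : Bool × Site L =>
    (coupling Jx Jy b.1 : ℂ) • PauliOp L (bondSpec L b)), Fintype.sum_bool, ← Finset.sum_add_distrib]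
  simp [bondSpec_true, bondSpec_false, coupling, add_comm]

/-- The coefficient equations of `[H, Q] = 0`. -/
theorem sum_bonds_eq_zero {L : ℕ} [NeZero L] (hL : 1 < L) {Jx Jy : ℝ} {q : PSpec L → ℂ}
    (hcons : opComm L (Hcompass L Jx Jy) (Qop L q) = 0) (τ : PSpec L) :
    ∑ b : Bool × Site L, (coupling Jx Jy b.1 : ℂ) * (bondSign b τ : ℂ) * q (toggle b τ) = 0 := by
  have hexp : opComm L (Hcompass L Jx Jy) (Qop L q)
      = - ∑ b : Bool × Site L, ∑ σ : PSpec L, ((coupling Jx Jy b.1 : ℂ) * q σ) •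
          opComm L (PauliOp L (bondSpec L b)) (PauliOp L σ) := by
    rw [Hcompass_eq_sum_bonds]
    simp only [opComm, Qop, neg_mul, mul_neg, Finset.sum_mul_sum, smul_sub,
      Finset.sum_sub_distrib, smul_mul_smul_comm]
    rw [Finset.sum_comm (f := fun σ b => (q σ * (coupling Jx Jy b.1 : ℂ)) •
      (PauliOp L σ * PauliOp L (bondSpec L b)))]
    simp only [mul_comm (q _)]
    abel
  have h0 := congrArg (fun M => Matrix.trace (PauliOp L τ * M)) (hexp.symm.trans hcons)
  simp only [mul_neg, Matrix.trace_neg, Finset.mul_sum, Matrix.trace_sum, Matrix.mul_smul,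
    Matrix.trace_smul, trace_opComm_bond hL, smul_eq_mul, mul_ite, mul_zero,
    Finset.sum_ite_eq', Finset.mem_univ, if_true, Matrix.trace_zero, neg_eq_zero] at h0
  have hne : (2 ^ Fintype.card (Site L) * (2 * Complex.I) : ℂ) ≠ 0 := by simp
  apply mul_left_cancel₀ hne
  rw [mul_zero, Finset.mul_sum, ← h0]
  exact Finset.sum_congr rfl fun b _ => by ring

/-- The diagonal on which a site lies. -/
def diagIdx {L : ℕ} (u : Site L) : ZMod L := u.1 + u.2

theorem diagIdx_add_bondDir {L : ℕ} (u : Site L) (d : Bool) :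
    diagIdx (u + bondDir L d) = diagIdx u + 1 := by
  cases d <;> simp [diagIdx, bondDir] <;> ring

theorem bondLetter_ne_zero (d : Bool) : bondLetter d ≠ 0 := by
  cases d <;> simp [bondLetter]

theorem bondLetter_injective : Function.Injective bondLetter := by decide

theorem toggle_apply_of_ne {L : ℕ} {b : Bool × Site L} {σ : PSpec L} {z : Site L}
    (h1 : z ≠ b.2) (h2 : z ≠ b.2 + bondDir L b.1) : toggle b σ z = σ z := by
  have : ∀ a : Fin 4, 0 ^^^ a = a := by decide
  simp [toggle, specMul, bondSpec, h1, h2, this]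

theorem toggle_apply_fst {L : ℕ} (b : Bool × Site L) (σ : PSpec L) :
    toggle b σ b.2 = bondLetter b.1 ^^^ σ b.2 := by
  simp [toggle, specMul, bondSpec]

theorem toggle_apply_snd {L : ℕ} (b : Bool × Site L) (σ : PSpec L) :
    toggle b σ (b.2 + bondDir L b.1) = bondLetter b.1 ^^^ σ (b.2 + bondDir L b.1) := by
  simp [toggle, specMul, bondSpec]

/-- A bond term with nonvanishing commutator can remove a site only if it carries the letter of
that site and its other site lies in the support before and after. -/
theorem removed_site {L : ℕ} {b : Bool × Site L} {σ : PSpec L} (hs : bondSign b σ ≠ 0)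
    {p : Site L} (hp : σ p ≠ 0) (hp' : toggle b σ p = 0) :
    σ p = bondLetter b.1 ∧
      ((p = b.2 ∧ σ (b.2 + bondDir L b.1) ≠ 0 ∧ σ (b.2 + bondDir L b.1) ≠ bondLetter b.1 ∧
          toggle b σ (b.2 + bondDir L b.1) ≠ 0) ∨
       (p = b.2 + bondDir L b.1 ∧ σ b.2 ≠ 0 ∧ σ b.2 ≠ bondLetter b.1 ∧ toggle b σ b.2 ≠ 0)) := by
  have hself : ∀ w : Fin 4, pairSign w w 0 = 0 ∧ pairSign w w w = 0 ∧ pairSign w 0 w = 0 := by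
    decide
  have hx : ∀ a c : Fin 4, a ≠ c → a ^^^ c ≠ 0 := by decide
  by_cases h1 : p = b.2
  · subst h1
    rw [toggle_apply_fst, fin4_xor_eq_zero_iff] at hp'
    have hn : σ (b.2 + bondDir L b.1) ≠ 0 := by
      intro h; exact hs (by rw [bondSign, ← hp', h]; exact (hself _).1)
    have hm : σ (b.2 + bondDir L b.1) ≠ bondLetter b.1 := by
      intro h; exact hs (by rw [bondSign, ← hp', h]; exact (hself _).2.1)
    refine ⟨hp'.symm, Or.inl ⟨rfl, hn, hm, ?_⟩⟩
    rw [toggle_apply_snd]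
    exact hx _ _ hm.symm
  by_cases h2 : p = b.2 + bondDir L b.1
  · subst h2
    rw [toggle_apply_snd, fin4_xor_eq_zero_iff] at hp'
    have hn : σ b.2 ≠ 0 := by
      intro h; exact hs (by rw [bondSign, ← hp', h]; exact (hself _).2.2)
    have hm : σ b.2 ≠ bondLetter b.1 := by
      intro h; exact hs (by rw [bondSign, ← hp', h]; exact (hself _).2.1)
    refine ⟨hp'.symm, Or.inr ⟨rfl, hn, hm, ?_⟩⟩
    rw [toggle_apply_fst]
    exact hx _ _ hm.symm
  · rw [toggle_apply_of_ne h1 h2] at hp'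
    exact absurd hp' hp

/-- If a bond term removes a site then every site it leaves in the support was there before. -/
theorem support_of_removed {L : ℕ} {b : Bool × Site L} {σ : PSpec L} (hs : bondSign b σ ≠ 0)
    {p : Site L} (hp : σ p ≠ 0) (hp' : toggle b σ p = 0) {z : Site L} (hz : toggle b σ z ≠ 0) :
    σ z ≠ 0 := by
  obtain ⟨-, ⟨rfl, h, -, -⟩ | ⟨rfl, h, -, -⟩⟩ := removed_site hs hp hp'
  · by_cases h1 : z = b.2
    · exact h1 ▸ hp
    by_cases h2 : z = b.2 + bondDir L b.1
    · exact h2 ▸ h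
    · rwa [toggle_apply_of_ne h1 h2] at hz
  · by_cases h1 : z = b.2
    · exact h1 ▸ h
    by_cases h2 : z = b.2 + bondDir L b.1
    · exact h2 ▸ hp
    · rwa [toggle_apply_of_ne h1 h2] at hz

/-- If only the bonds in `S` contribute then the coefficient equation reduces to `S`. -/
theorem sum_bonds_subset {L : ℕ} [NeZero L] (hL : 1 < L) {Jx Jy : ℝ} {q : PSpec L → ℂ}
    (hcons : opComm L (Hcompass L Jx Jy) (Qop L q) = 0) (τ : PSpec L)
    (S : Finset (Bool × Site L))
    (hS : ∀ b, bondSign b τ ≠ 0 → q (toggle b τ) ≠ 0 → b ∈ S) :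
    ∑ b ∈ S, (coupling Jx Jy b.1 : ℂ) * (bondSign b τ : ℂ) * q (toggle b τ) = 0 := by
  rw [← sum_bonds_eq_zero hL hcons τ]
  refine Finset.sum_subset (Finset.subset_univ S) fun b _ hb => ?_
  by_contra h
  simp only [mul_eq_zero, not_or] at h
  exact hb (hS b (by exact_mod_cast h.1.2) h.2)

theorem exists_diagBoundAt {L k : ℕ} [NeZero L] {σ : PSpec L} (h : Diag L σ ≤ k) :
    ∃ a, DiagBoundAt L σ a k := by
  have hne : {k | ∃ a : ZMod L, DiagBoundAt L σ a k}.Nonempty :=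
    ⟨L, 0, fun u _ => ZMod.val_lt _⟩
  obtain ⟨a, ha⟩ := Nat.sInf_mem hne
  exact ⟨a, fun u hu => (ha u hu).trans_le h⟩

theorem val_sub_of_eq_add {L : ℕ} {x y a : ZMod L} {i : ℕ} (h : y = x + i)
    (hi : (x - a).val + i < L) : (y - a).val = (x - a).val + i := by
  have : NeZero L := ⟨by omega⟩
  have e : y - a = (((x - a).val + i : ℕ) : ZMod L) := by
    rw [Nat.cast_add, ZMod.natCast_zmod_val, h]; ring
  rw [e, ZMod.val_cast_of_lt hi]

/-- A product of diagonal length at most `k` has no two sites exactly `k` diagonals apart. -/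
theorem not_apart_of_diagBoundAt {L k : ℕ} (hkL : 2 * k ≤ L) {σ : PSpec L} {b : ZMod L}
    (hb : DiagBoundAt L σ b k) {p r : Site L} (hp : σ p ≠ 0) (hr : σ r ≠ 0)
    (h : diagIdx r = diagIdx p + k) : False := by
  have h1 := hb p hp
  have h2 := hb r hr
  have := val_sub_of_eq_add (a := b) h (by simp only [diagIdx]; omega)
  simp only [diagIdx] at this
  omega

/-- A product of diagonal length at most `k` with two sites `k - 1` diagonals apart lies in the
window spanned by them. -/
theorem diagBoundAt_of_apart {L k : ℕ} (hkL : 2 * k ≤ L) {σ : PSpec L} {b : ZMod L}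
    (hb : DiagBoundAt L σ b k) {p r : Site L} (hp : σ p ≠ 0) (hr : σ r ≠ 0)
    (h : diagIdx r = diagIdx p + (k - 1 : ℕ)) : DiagBoundAt L σ (diagIdx p) k := by
  have h1 := hb p hp
  have h2 := hb r hr
  have := val_sub_of_eq_add (a := b) h (by simp only [diagIdx]; omega)
  simp only [diagIdx] at this
  have h3 : (p.1 + p.2 - b).val = 0 := by omega
  rw [ZMod.val_eq_zero, sub_eq_zero] at h3
  rw [diagIdx, h3]
  exact hb

theorem natCast_zmod_inj {L : ℕ} {x : ZMod L} {i j : ℕ} (h : x + i = x + j) (hi : i < L)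
    (hj : j < L) : i = j := by
  have := congrArg ZMod.val (add_left_cancel h)
  rwa [ZMod.val_cast_of_lt hi, ZMod.val_cast_of_lt hj] at this

theorem diagBoundAt_iff {L k : ℕ} [NeZero L] (hk : k ≤ L) (σ : PSpec L) (a : ZMod L) :
    DiagBoundAt L σ a k ↔ ∀ u, σ u ≠ 0 → ∃ i < k, diagIdx u = a + (i : ℕ) := by
  refine forall₂_congr fun u _ => ⟨fun h => ⟨_, h, ?_⟩, ?_⟩
  · rw [ZMod.natCast_zmod_val, diagIdx]; ring
  · rintro ⟨i, hi, h⟩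
    rw [diagIdx] at h
    rwa [h, add_sub_cancel_left, ZMod.val_cast_of_lt (by omega)]

/-- Which bonds can turn a product of diagonal length `k + 1` into one of diagonal length at
most `k`. -/
theorem bond_of_shrink {L k : ℕ} [NeZero L] (hk : 2 ≤ k) (hkL : 2 * k ≤ L)
    {σ : PSpec L} {a : ZMod L} (ha : ∀ u, σ u ≠ 0 → ∃ i < k + 1, diagIdx u = a + (i : ℕ))
    {p r : Site L} (hp : σ p ≠ 0) (hr : σ r ≠ 0) (hpa : diagIdx p = a)
    (hra : diagIdx r = a + (k : ℕ))
    {b : Bool × Site L} (hs : bondSign b σ ≠ 0) (hD : Diag L (toggle b σ) ≤ k) :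
    (∃ d, b = (d, p) ∧ σ p = bondLetter d ∧ toggle b σ p = 0 ∧ σ (p + bondDir L d) ≠ 0 ∧
      toggle b σ (p + bondDir L d) ≠ 0) ∨
    (∃ d, b = (d, r - bondDir L d) ∧ σ r = bondLetter d) := by
  obtain ⟨c, hc⟩ := exists_diagBoundAt hD
  obtain ⟨d, z⟩ := b
  by_cases h1 : toggle (d, z) σ p = 0
  · left
    obtain ⟨h2, ⟨rfl, h, -, h'⟩ | ⟨rfl, h, -⟩⟩ := removed_site hs hp h1
    · exact ⟨d, rfl, h2, h1, h, h'⟩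
    · exfalso
      obtain ⟨i, hi, h3⟩ := ha _ h
      rw [diagIdx_add_bondDir, h3] at hpa
      have : a + ((i + 1 : ℕ) : ZMod L) = a + (0 : ℕ) := by push_cast; rw [← add_assoc, hpa]; simp
      have := natCast_zmod_inj this (by omega) (by omega)
      omega
  by_cases h1' : toggle (d, z) σ r = 0
  · right
    obtain ⟨h2, ⟨rfl, h, -⟩ | ⟨rfl, h, -⟩⟩ := removed_site hs hr h1'
    · exfalso
      obtain ⟨i, hi, h3⟩ := ha _ h
      rw [diagIdx_add_bondDir, hra] at h3
      have : a + ((k + 1 : ℕ) : ZMod L) = a + (i : ℕ) := by push_cast; rw [← add_assoc, h3]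
      have := natCast_zmod_inj this (by omega) (by omega)
      omega
    · exact ⟨d, by simp, h2⟩
  · exact (not_apart_of_diagBoundAt hkL hc h1 h1' (by rw [hra, hpa])).elim

/-- A product of diagonal length `k` in a conserved quantity has at most one site on each
diagonal. -/
theorem coeff_eq_zero_of_two_sites {L : ℕ} [NeZero L] {Jx Jy : ℝ} (hJx : Jx ≠ 0) (hJy : Jy ≠ 0)
    {k : ℕ} (hk : 2 ≤ k) (hkL : 2 * k ≤ L) {q : PSpec L → ℂ}
    (hsupp : ∀ σ : PSpec L, q σ ≠ 0 → Diag L σ ≤ k)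
    (hcons : opComm L (Hcompass L Jx Jy) (Qop L q) = 0)
    (n : ℕ) (hn : n < k) (σ : PSpec L) (a : ZMod L)
    (ha : ∀ u, σ u ≠ 0 → ∃ i < k, diagIdx u = a + (i : ℕ))
    {p r : Site L} (hp : σ p ≠ 0) (hpa : diagIdx p = a)
    (hr : σ r ≠ 0) (hra : diagIdx r = a + (k - 1 : ℕ))
    {y z : Site L} (hyz : y ≠ z) (hy : σ y ≠ 0) (hz : σ z ≠ 0)
    (hya : diagIdx y = a + (n : ℕ)) (hza : diagIdx z = a + (n : ℕ)) : q σ = 0 := by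
  induction n using Nat.strong_induction_on generalizing σ a p r with
  | _ n ih =>
  obtain ⟨d, hd⟩ : ∃ d, σ r ≠ bondLetter d := by
    by_contra! h
    exact absurd ((h true).symm.trans (h false)) (by decide)
  have hL : 1 < L := by omega
  have hdiag : ∀ {x y : Site L} {i j : ℕ}, diagIdx x = a + (i : ℕ) → diagIdx y = a + (j : ℕ) →
      i < L → j < L → i ≠ j → x ≠ y := fun hx hy hi hj hij e =>
    hij (natCast_zmod_inj (hx.symm.trans ((congrArg diagIdx e).trans hy)) hi hj)
  have hpa0 : diagIdx p = a + (0 : ℕ) := by simpa using hpa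
  have hwa : diagIdx (r + bondDir L d) = a + (k : ℕ) := by
    rw [diagIdx_add_bondDir, hra, add_assoc, ← Nat.cast_succ]
    congr 2; omega
  have hσw : σ (r + bondDir L d) = 0 := by
    by_contra h
    obtain ⟨i, hi, hi'⟩ := ha _ h
    exact hdiag hwa hi' (by omega) (by omega) (by omega) rfl
  have hτw : toggle (d, r) σ (r + bondDir L d) = bondLetter d := by
    have : ∀ c : Fin 4, c ^^^ 0 = c := by decide
    exact (toggle_apply_snd (d, r) σ).trans (by simp only [hσw, this])
  have hτr : toggle (d, r) σ r = bondLetter d ^^^ σ r := toggle_apply_fst (d, r) σ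
  have hkeep : ∀ u, σ u ≠ 0 → toggle (d, r) σ u ≠ 0 := by
    intro u hu
    by_cases h1 : u = r
    · rw [h1, hτr, Ne, fin4_xor_eq_zero_iff]
      exact hd.symm
    · rwa [toggle_apply_of_ne (b := (d, r)) h1 (fun h => hu ((congrArg σ h).trans hσw))]
  have hbound : ∀ u, toggle (d, r) σ u ≠ 0 → ∃ i < k + 1, diagIdx u = a + (i : ℕ) := by
    intro u hu
    by_cases h2 : u = r + bondDir L d
    · exact ⟨k, by omega, h2 ▸ hwa⟩
    by_cases h1 : u = r
    · exact ⟨k - 1, by omega, h1 ▸ hra⟩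
    · rw [toggle_apply_of_ne h1 h2] at hu
      obtain ⟨i, hi, hi'⟩ := ha u hu
      exact ⟨i, by omega, hi'⟩
  have hsign : bondSign (d, r) (toggle (d, r) σ) ≠ 0 := by
    have : ∀ w c : Fin 4, c ≠ 0 → c ≠ w → pairSign w (w ^^^ c) w ≠ 0 := by decide
    simp only [bondSign, hτw, hτr]
    exact this _ _ hr hd
  have hτw0 : toggle (d, r) σ (r + bondDir L d) ≠ 0 := hτw ▸ bondLetter_ne_zero d
  have hsum := sum_bonds_subset hL hcons (toggle (d, r) σ) {(d, r)} ?_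
  · rw [Finset.sum_singleton, toggle_toggle_self] at hsum
    have hJ : (coupling Jx Jy d : ℂ) ≠ 0 := by
      cases d <;> simpa [coupling]
    simpa [hJ, hsign] using hsum
  intro b hb hqb
  rw [Finset.mem_singleton]
  rcases bond_of_shrink hk hkL hbound (hkeep p hp) hτw0 hpa hwa hb (hsupp _ hqb) with
    ⟨d', rfl, -, hp0, hnext, hnext'⟩ | ⟨d', rfl, hd'⟩
  swap
  · rw [hτw] at hd'
    rw [← bondLetter_injective hd']
    simp
  exfalso
  obtain ⟨c, hc⟩ := exists_diagBoundAt (hsupp _ hqb)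
  have hpd : diagIdx (p + bondDir L d') = a + (1 : ℕ) := by
    rw [diagIdx_add_bondDir, hpa]; simp
  have hsurv : ∀ u, toggle (d, r) σ u ≠ 0 → u ≠ p →
      toggle (d', p) (toggle (d, r) σ) u ≠ 0 := by
    intro u hu hup
    by_cases h : u = p + bondDir L d'
    · rwa [h]
    · rwa [toggle_apply_of_ne hup h]
  have hw' := hsurv _ hτw0 (hdiag hwa hpa0 (by omega) (by omega) (by omega))
  have hnot : ∀ u, toggle (d', p) (toggle (d, r) σ) u ≠ 0 → diagIdx u = a + (0 : ℕ) → False := by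
    intro u hu hua
    refine not_apart_of_diagBoundAt hkL hc hu hw' ?_
    rw [hwa, hua]; simp
  rcases Nat.eq_zero_or_pos n with rfl | hn0
  · by_cases h : y = p
    · exact hnot z (hsurv z (hkeep z hz) (fun h' => hyz (h.trans h'.symm))) hza
    · exact hnot y (hsurv y (hkeep y hy) h) hya
  · have hsucc : ∀ {i : ℕ}, 0 < i → a + (i : ℕ) = a + 1 + (i - 1 : ℕ) := by
      intro i hi
      rw [add_assoc, add_comm 1, ← Nat.cast_succ]
      congr 2; omega
    refine hqb (ih (n - 1) (by omega) (by omega) _ (a + 1) ?_ hnext' (by simpa using hpd) hw' ?_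
      (hsurv y (hkeep y hy) (hdiag hya hpa0 (by omega) (by omega) (by omega)))
      (hsurv z (hkeep z hz) (hdiag hza hpa0 (by omega) (by omega) (by omega)))
      (hya.trans (hsucc hn0)) (hza.trans (hsucc hn0)))
    · intro u hu
      obtain ⟨i, hi, hi'⟩ := hbound u (support_of_removed hb (hkeep p hp) hp0 hu)
      have : i ≠ 0 := by
        rintro rfl
        exact hnot u hu hi'
      exact ⟨i - 1, by omega, hi'.trans (hsucc (by omega))⟩
    · exact hwa.trans (hsucc (by omega))

/-- The bond joining the sites `u_i` and `u_{i+1}` of the staircase. -/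
def stairBond (L : ℕ) (u : Site L) (i : ℕ) : Bool × Site L := (decide (i % 2 = 0), stair L u i)

theorem stair_succ_s12 {L : ℕ} (u : Site L) {i : ℕ} (hi : 1 ≤ i) :
    stair L u (i + 1) = stair L u i + bondDir L (decide (i % 2 = 0)) := by
  rcases Nat.even_or_odd' i with ⟨m, rfl | rfl⟩
  · have h1 : (2 * m + 1) % 2 = 1 := by omega
    have h2 : 2 * m % 2 = 0 := by omega
    simp [stair, bondDir, h1]
  · have h1 : (2 * m + 1) % 2 = 1 := by omega
    have h2 : (2 * m + 1 + 1) % 2 = 0 := by omega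
    have h3 : (2 * m + 1 + 1) / 2 = m + 1 := by omega
    ext <;> simp [stair, bondDir, h1, h2, h3]
    all_goals ring

theorem stairBond_snd {L : ℕ} (u : Site L) {i : ℕ} (hi : 1 ≤ i) :
    (stairBond L u i).2 + bondDir L (stairBond L u i).1 = stair L u (i + 1) :=
  (stair_succ_s12 u hi).symm

theorem diagIdx_stair_add {L : ℕ} (u : Site L) {j : ℕ} (hj : 1 ≤ j) (i : ℕ) :
    diagIdx (stair L u (j + i)) = diagIdx (stair L u j) + (i : ℕ) := by
  induction i with
  | zero => simp
  | succ i ih =>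
    rw [← add_assoc, stair_succ_s12 u (by omega), diagIdx_add_bondDir, ih]
    push_cast; ring

theorem stair_inj_s12 {L : ℕ} (u : Site L) {j : ℕ} (hj : 1 ≤ j) {i m : ℕ} (hi : j ≤ i) (hm : j ≤ m)
    (hiL : i < j + L) (hmL : m < j + L) : stair L u i = stair L u m ↔ i = m := by
  refine ⟨fun h => ?_, fun h => h ▸ rfl⟩
  obtain ⟨i, rfl⟩ := Nat.exists_eq_add_of_le hi
  obtain ⟨m, rfl⟩ := Nat.exists_eq_add_of_le hm
  have := congrArg diagIdx h
  rw [diagIdx_stair_add u hj, diagIdx_stair_add u hj] at this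
  rw [natCast_zmod_inj this (by omega) (by omega)]

theorem endL_eq_bondLetter (i : ℕ) : endL i = bondLetter (decide (i % 2 = 0)) := by
  rcases Nat.mod_two_eq_zero_or_one i with h | h <;> simp [endL, bondLetter, h]

theorem endR_eq_endL {k : ℕ} (hk : k % 2 = 0) (j : ℕ) : endR k j = endL j := by
  simp [endR, endL, hk]

theorem Cspec_stair {L : ℕ} (u : Site L) {k j i : ℕ} (hj : 1 ≤ j) (hkeven : k % 2 = 0)
    (hk : 2 ≤ k) (hkL : 2 * k ≤ L) (hi : j ≤ i) (hiL : i < j + L) :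
    Cspec L k j u (stair L u i) =
      if i = j ∨ i = j + k - 1 then endL j else if i < j + k - 1 then 3 else 0 := by
  have h3 : stair L u i ∈ (Finset.Icc (j + 1) (j + k - 2)).image (stair L u) ↔
      j < i ∧ i < j + k - 1 := by
    simp only [Finset.mem_image, Finset.mem_Icc]
    constructor
    · rintro ⟨m, hm, h⟩
      have := (stair_inj_s12 u hj (by omega) hi (by omega) hiL).1 h
      omega
    · rintro ⟨h1, h2⟩
      exact ⟨i, by omega, rfl⟩
  simp only [Cspec, stair_inj_s12 u hj hi le_rfl hiL (by omega : j < j + L),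
    stair_inj_s12 u hj hi (by omega : j ≤ j + k - 1) hiL (by omega), endR_eq_endL hkeven, h3]
  split_ifs <;> first | rfl | omega

theorem Cspec_support {L : ℕ} {u : Site L} {k j : ℕ} (hk : 2 ≤ k) {z : Site L}
    (h : Cspec L k j u z ≠ 0) : ∃ i, j ≤ i ∧ i < j + k ∧ z = stair L u i := by
  unfold Cspec at h
  split_ifs at h with h1 h2 h3
  · exact ⟨j, le_rfl, by omega, h1⟩
  · exact ⟨j + k - 1, by omega, by omega, h2⟩
  · obtain ⟨i, hi, rfl⟩ := Finset.mem_image.1 h3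
    rw [Finset.mem_Icc] at hi
    exact ⟨i, by omega, by omega, rfl⟩
  · exact absurd rfl h

theorem Cspec_stair_eq_zero {L : ℕ} (u : Site L) {k j : ℕ} (hj : 1 ≤ j)
    (hk : 2 ≤ k) (hkL : 2 * k ≤ L) : Cspec L k (j + 1) u (stair L u j) = 0 := by
  by_contra h
  obtain ⟨i, h1, h2, h3⟩ := Cspec_support hk h
  have := (stair_inj_s12 u hj le_rfl (by omega) (by omega) (by omega)).1 h3
  omega

theorem toggle_stairBond {L : ℕ} (u : Site L) (σ : PSpec L) {j i m : ℕ} (hj : 1 ≤ j)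
    (hi : j ≤ i) (hm : j ≤ m) (hiL : i < j + L) (hmL : m + 1 < j + L) :
    toggle (stairBond L u m) σ (stair L u i) =
      if i = m ∨ i = m + 1 then endL m ^^^ σ (stair L u i) else σ (stair L u i) := by
  have h0 : ∀ a : Fin 4, 0 ^^^ a = a := by decide
  simp only [toggle, specMul, bondSpec, stairBond_snd u (hj.trans hm)]
  simp only [stairBond, stair_inj_s12 u hj hi hm hiL (by omega),
    stair_inj_s12 u hj hi (hm.trans (Nat.le_succ m)) hiL (by omega), endL_eq_bondLetter]
  split_ifs <;> simp [h0]

theorem support_toggle {L : ℕ} {b : Bool × Site L} {σ : PSpec L} {z : Site L}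
    (h : toggle b σ z ≠ 0) : z = b.2 ∨ z = b.2 + bondDir L b.1 ∨ σ z ≠ 0 := by
  by_contra! h'
  exact h ((toggle_apply_of_ne h'.1 h'.2.1).trans h'.2.2)

/-- Extending `C^k_j` at its top right end is the same as extending `C^k_{j+1}` at its bottom
left end. -/
theorem toggle_Cspec_eq {L : ℕ} (u : Site L) {k j : ℕ} (hj : 1 ≤ j) (hkeven : k % 2 = 0)
    (hk : 4 ≤ k) (hkL : 2 * k ≤ L) :
    toggle (stairBond L u (j + k - 1)) (Cspec L k j u)
      = toggle (stairBond L u j) (Cspec L k (j + 1) u) := by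
  funext z
  by_cases hz : ∃ i, j ≤ i ∧ i ≤ j + k ∧ z = stair L u i
  · obtain ⟨i, hi, hi', rfl⟩ := hz
    rw [toggle_stairBond u _ hj hi (by omega) (by omega) (by omega),
      toggle_stairBond u _ hj hi le_rfl (by omega) (by omega),
      Cspec_stair u hj hkeven (by omega) hkL hi (by omega)]
    have hpar : (j + k - 1) % 2 = (j + 1) % 2 := by omega
    have hlam : endL (j + k - 1) = endL (j + 1) := by simp only [endL, hpar]
    have hx : endL j ^^^ endL (j + 1) = 3 ∧ endL (j + 1) ^^^ endL j = 3 ∧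
        endL (j + 1) ^^^ 3 = endL j ∧ endL j ^^^ 3 = endL (j + 1) ∧ endL j ^^^ endL j = 0 ∧
        endL (j + 1) ^^^ 0 = endL (j + 1) ∧ endL j ^^^ 0 = endL j := by
      rcases Nat.mod_two_eq_zero_or_one j with h | h
      · have : (j + 1) % 2 = 1 := by omega
        simp [endL, h, this]
      · have : (j + 1) % 2 = 0 := by omega
        simp [endL, h, this]
    rcases hi.eq_or_lt with rfl | hji
    · rw [Cspec_stair_eq_zero u hj (by omega) hkL]
      split_ifs <;> first | (exfalso; omega) | simp only [hx]
    · rw [Cspec_stair u (by omega) hkeven (by omega) hkL hji (by omega)]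
      split_ifs <;> first | (exfalso; omega) | simp only [hlam, hx]
  · have h1 : toggle (stairBond L u (j + k - 1)) (Cspec L k j u) z = 0 := by
      by_contra h
      rcases support_toggle h with h | h | h
      · exact hz ⟨_, by omega, by omega, h⟩
      · rw [stairBond_snd u (by omega)] at h
        exact hz ⟨_, by omega, by omega, h⟩
      · obtain ⟨i, h1, h2, h3⟩ := Cspec_support (by omega) h
        exact hz ⟨i, h1, by omega, h3⟩
    have h2 : toggle (stairBond L u j) (Cspec L k (j + 1) u) z = 0 := by
      by_contra h
      rcases support_toggle h with h | h | h
      · exact hz ⟨_, by omega, by omega, h⟩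
      · rw [stairBond_snd u (by omega)] at h
        exact hz ⟨_, by omega, by omega, h⟩
      · obtain ⟨i, h1, h2, h3⟩ := Cspec_support (by omega) h
        exact hz ⟨i, by omega, by omega, h3⟩
    rw [h1, h2]

theorem bondSign_stairBond {L : ℕ} (u : Site L) (σ : PSpec L) {i : ℕ} (hi : 1 ≤ i) :
    bondSign (stairBond L u i) σ
      = pairSign (endL i) (σ (stair L u i)) (σ (stair L u (i + 1))) := by
  rw [bondSign, stairBond_snd u hi, endL_eq_bondLetter]; rfl

theorem endL_congr {i j : ℕ} (h : i % 2 = j % 2) : endL i = endL j := by simp only [endL, h]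

/-- Neighbouring standard-form products have proportional coefficients. -/
theorem coupling_mul_coeff_succ {L : ℕ} [NeZero L] {Jx Jy : ℝ} {k : ℕ} (hkeven : k % 2 = 0)
    (hk : 4 ≤ k) (hkL : 2 * k ≤ L) {q : PSpec L → ℂ}
    (hsupp : ∀ σ : PSpec L, q σ ≠ 0 → Diag L σ ≤ k)
    (hcons : opComm L (Hcompass L Jx Jy) (Qop L q) = 0) (u : Site L) {j : ℕ} (hj : 1 ≤ j) :
    (coupling Jx Jy (decide (j % 2 = 0)) : ℂ) * q (Cspec L k (j + 1) u)
      = (coupling Jx Jy (decide ((j + 1) % 2 = 0)) : ℂ) * q (Cspec L k j u) := by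
  have hpar : (j + k - 1) % 2 = (j + 1) % 2 := by omega
  have hC := fun i (hi : j ≤ i) (hiL : i < j + L) =>
    Cspec_stair u hj hkeven (by omega) hkL hi hiL
  set τ := toggle (stairBond L u (j + k - 1)) (Cspec L k j u) with hτ
  have hval := fun i (hi : j ≤ i) (hiL : i < j + L) =>
    toggle_stairBond u (Cspec L k j u) (m := j + k - 1) hj hi (by omega) hiL (by omega)
  rw [← hτ] at hval
  have h3 : endL (j + 1) ^^^ endL j = 3 ∧ endL (j + 1) ^^^ 0 = endL (j + 1) := by
    rcases Nat.mod_two_eq_zero_or_one j with h | h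
    · have : (j + 1) % 2 = 1 := by omega
      simp [endL, h, this]
    · have : (j + 1) % 2 = 0 := by omega
      simp [endL, h, this]
  have hvj : τ (stair L u j) = endL j := by
    rw [hval j le_rfl (by omega), hC j le_rfl (by omega), if_neg (by omega), if_pos (by omega)]
  have hvj1 : τ (stair L u (j + 1)) = 3 := by
    rw [hval _ (by omega) (by omega), hC _ (by omega) (by omega), if_neg (by omega),
      if_neg (by omega), if_pos (by omega)]
  have hvt : τ (stair L u (j + k - 1)) = 3 := by
    rw [hval _ (by omega) (by omega), hC _ (by omega) (by omega), if_pos (by omega),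
      if_pos (by omega), endL_congr hpar, h3.1]
  have hvt1 : τ (stair L u (j + k)) = endL (j + 1) := by
    rw [hval _ (by omega) (by omega), hC _ (by omega) (by omega), if_pos (by omega),
      if_neg (by omega), if_neg (by omega), endL_congr hpar, h3.2]
  have hbound : ∀ z, τ z ≠ 0 → ∃ i < k + 1, diagIdx z = diagIdx (stair L u j) + (i : ℕ) := by
    intro z hz
    obtain ⟨i, hi, hi', rfl⟩ : ∃ i, j ≤ i ∧ i < j + (k + 1) ∧ z = stair L u i := by
      rcases support_toggle hz with h | h | h
      · exact ⟨_, by omega, by omega, h⟩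
      · rw [stairBond_snd u (by omega)] at h
        exact ⟨_, by omega, by omega, h⟩
      · obtain ⟨i, h1, h2, h3⟩ := Cspec_support (by omega) h
        exact ⟨i, h1, by omega, h3⟩
    exact ⟨i - j, by omega, by rw [← diagIdx_stair_add u hj, Nat.add_sub_cancel' hi]⟩
  have hne : stairBond L u (j + k - 1) ≠ stairBond L u j := by
    intro h
    have := (stair_inj_s12 u hj (by omega) le_rfl (by omega) (by omega)).1 (congrArg Prod.snd h)
    omega
  have hends : ∀ i, endL i ≠ 0 := fun i => by
    rw [endL_eq_bondLetter]; exact bondLetter_ne_zero _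
  have hsum := sum_bonds_subset (by omega) hcons τ
    {stairBond L u (j + k - 1), stairBond L u j} ?_
  · rw [Finset.sum_pair hne, hτ, toggle_toggle_self, toggle_Cspec_eq u hj hkeven hk hkL,
      toggle_toggle_self, ← toggle_Cspec_eq u hj hkeven hk hkL, ← hτ,
      bondSign_stairBond u τ hj, bondSign_stairBond u τ (by omega), Nat.sub_add_cancel (by omega),
      hvj, hvj1, hvt, hvt1, endL_congr hpar] at hsum
    simp only [stairBond, hpar] at hsum
    rcases Nat.mod_two_eq_zero_or_one j with h | h
    · have h' : (j + 1) % 2 = 1 := by omega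
      simp [endL, h, h', pairSign, letterSign] at hsum ⊢
      linear_combination -hsum
    · have h' : (j + 1) % 2 = 0 := by omega
      simp [endL, h, h', pairSign, letterSign] at hsum ⊢
      linear_combination hsum
  intro b hb hqb
  rw [Finset.mem_insert, Finset.mem_singleton]
  rcases bond_of_shrink (by omega) hkL hbound (hvj ▸ hends j) (hvt1 ▸ hends (j + 1)) rfl
    (diagIdx_stair_add u hj k) hb (hsupp _ hqb) with ⟨d, rfl, hd, -⟩ | ⟨d, rfl, hd⟩
  · right
    rw [hvj, endL_eq_bondLetter] at hd
    rw [← bondLetter_injective hd]; rfl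
  · left
    rw [hvt1, ← endL_congr hpar, endL_eq_bondLetter] at hd
    have := stair_succ_s12 u (i := j + k - 1) (by omega)
    rw [Nat.sub_add_cancel (by omega)] at this
    rw [← bondLetter_injective hd, this, add_sub_cancel_right]; rfl

/-- The bond in the `x` direction leaving the staircase at its site `u_k`, `k` even. -/
def sideBond (L : ℕ) (u : Site L) (k : ℕ) : Bool × Site L := (false, stair L u k)

/-- `C^k_j` multiplied by the bond term leaving the staircase at `u_k`, up to phase. -/
def sideSpec (L : ℕ) (k j : ℕ) (u : Site L) : PSpec L :=
  toggle (sideBond L u k) (Cspec L k j u)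

/-- The coefficient of `sideSpec` with its top right site removed. -/
def sideCoeff {L : ℕ} (q : PSpec L → ℂ) (k j : ℕ) (u : Site L) : ℂ :=
  q (toggle (stairBond L u (j + k - 2)) (sideSpec L k j u))

theorem toggle_sideSpec_eq {L : ℕ} (u : Site L) {k j : ℕ} (hj : 1 ≤ j) (hkeven : k % 2 = 0)
    (hk : 4 ≤ k) (hkL : 2 * k ≤ L) :
    toggle (stairBond L u j) (sideSpec L k j u)
      = toggle (stairBond L u (j + 1 + k - 2)) (sideSpec L k (j + 1) u) := by
  have h : Cspec L k j u = toggle (stairBond L u (j + k - 1))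
      (toggle (stairBond L u j) (Cspec L k (j + 1) u)) := by
    rw [← toggle_Cspec_eq u hj hkeven hk hkL, toggle_toggle_self]
  rw [sideSpec, sideSpec, h, show j + 1 + k - 2 = j + k - 1 by omega,
    toggle_comm _ (sideBond L u k), toggle_comm (stairBond L u j) (stairBond L u (j + k - 1)),
    toggle_toggle_self, toggle_comm (sideBond L u k)]

theorem bondDir_injective {L : ℕ} (hL : 1 < L) : Function.Injective (bondDir L) := by
  have : Fact (1 < L) := ⟨hL⟩
  intro d d'
  cases d <;> cases d' <;> simp [bondDir, Prod.ext_iff]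

theorem side_site_ne_stair {L : ℕ} (u : Site L) {k j i : ℕ} (hkeven : k % 2 = 0) (hj : 1 ≤ j)
    (hjk : j ≤ k) (hkL : k + 1 < j + L) (hi : j ≤ i) (hiL : i < j + L) :
    stair L u k + bondDir L false ≠ stair L u i := by
  intro h
  have h1 : stair L u (k + 1) = stair L u k + bondDir L true := by
    rw [stair_succ_s12 u (by omega)]; simp [hkeven]
  have h2 : diagIdx (stair L u (k + 1)) = diagIdx (stair L u i) := by
    rw [← h, h1, diagIdx_add_bondDir, diagIdx_add_bondDir]
  obtain ⟨i, rfl⟩ := Nat.exists_eq_add_of_le hi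
  obtain ⟨m, hm⟩ := Nat.exists_eq_add_of_le (show j ≤ k + 1 by omega)
  rw [hm, diagIdx_stair_add u hj, diagIdx_stair_add u hj] at h2
  have := natCast_zmod_inj h2 (by omega) (by omega)
  subst this
  rw [← hm, h1] at h
  exact absurd (bondDir_injective (by omega) (add_left_cancel h)) (by decide)

theorem sideSpec_stair {L : ℕ} (u : Site L) {k j i : ℕ} (hkeven : k % 2 = 0) (hj : 1 ≤ j)
    (hjk : j ≤ k) (hk : 4 ≤ k) (hkL : 2 * k ≤ L) (hi : j ≤ i) (hiL : i < j + L) :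
    sideSpec L k j u (stair L u i) =
      if i = k then 1 ^^^ Cspec L k j u (stair L u i) else Cspec L k j u (stair L u i) := by
  split_ifs with h
  · subst h
    exact toggle_apply_fst (sideBond L u i) (Cspec L i j u)
  · refine toggle_apply_of_ne ?_ ?_
    · exact fun h' => h ((stair_inj_s12 u hj hi hjk hiL (by omega)).1 h')
    · exact (side_site_ne_stair u hkeven hj hjk (by omega) hi hiL).symm

theorem sideSpec_side {L : ℕ} (u : Site L) {k j : ℕ} (hkeven : k % 2 = 0) (hj : 1 ≤ j)
    (hjk : j ≤ k) (hk : 4 ≤ k) (hkL : 2 * k ≤ L) :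
    sideSpec L k j u (stair L u k + bondDir L false) = 1 := by
  have h0 : Cspec L k j u (stair L u k + bondDir L false) = 0 := by
    by_contra h
    obtain ⟨i, h1, h2, h3⟩ := Cspec_support (by omega) h
    exact side_site_ne_stair u hkeven hj hjk (by omega) h1 (by omega) h3
  refine (toggle_apply_snd (sideBond L u k) (Cspec L k j u)).trans ?_
  simp only [sideBond, h0]
  decide

theorem sideSpec_support {L : ℕ} {u : Site L} {k j : ℕ} (hjk : j ≤ k) (hj : 1 ≤ j) (hk : 4 ≤ k)
    {z : Site L} (h : sideSpec L k j u z ≠ 0) :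
    z = stair L u k + bondDir L false ∨ ∃ i, j ≤ i ∧ i < j + k ∧ z = stair L u i := by
  rcases support_toggle h with h | h | h
  · exact Or.inr ⟨k, hjk, by omega, h⟩
  · exact Or.inl h
  · exact Or.inr (Cspec_support (by omega) h)

/-- The bonds that contribute to the coefficient equation of `sideSpec`. -/
theorem bond_of_sideSpec {L : ℕ} [NeZero L] {Jx Jy : ℝ} (hJx : Jx ≠ 0) (hJy : Jy ≠ 0) {k : ℕ}
    (hkeven : k % 2 = 0) (hk : 4 ≤ k) (hkL : 2 * k ≤ L) {q : PSpec L → ℂ}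
    (hsupp : ∀ σ : PSpec L, q σ ≠ 0 → Diag L σ ≤ k)
    (hcons : opComm L (Hcompass L Jx Jy) (Qop L q) = 0) (u : Site L) {j : ℕ} (hj : 2 ≤ j)
    (hjk : j ≤ k) {b : Bool × Site L} (hb : bondSign b (sideSpec L k j u) ≠ 0)
    (hqb : q (toggle b (sideSpec L k j u)) ≠ 0) :
    b = sideBond L u k ∨ b = stairBond L u j ∨ b = stairBond L u (j + k - 2) := by
  have hj1 : 1 ≤ j := by omega
  have hL : 1 < L := by omega
  have hends : ∀ i, endL i ≠ 0 := fun i => by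
    rw [endL_eq_bondLetter]; exact bondLetter_ne_zero _
  have h3 : ∀ d, (3 : Fin 4) ≠ bondLetter d := by decide
  have hval := fun i (hi : j ≤ i) (hiL : i < j + L) =>
    (sideSpec_stair u hkeven hj1 hjk hk hkL hi hiL).trans
      (by rw [Cspec_stair u hj1 hkeven (by omega) hkL hi hiL])
  have hside := sideSpec_side u hkeven hj1 hjk hk hkL
  have hsupp' := fun z => sideSpec_support (L := L) (u := u) hjk hj1 hk (z := z)
  have hdv : diagIdx (stair L u k + bondDir L false)
      = diagIdx (stair L u j) + (k + 1 - j : ℕ) := by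
    rw [diagIdx_add_bondDir, ← Nat.add_sub_cancel' hjk, diagIdx_stair_add u hj1, add_assoc,
      ← Nat.cast_succ]
    congr 2; omega
  have hdstair : ∀ i, j ≤ i → diagIdx (stair L u i) = diagIdx (stair L u j) + (i - j : ℕ) :=
    fun i hi => by rw [← diagIdx_stair_add u hj1, Nat.add_sub_cancel' hi]
  set τ := sideSpec L k j u
  have hbound : ∀ z, τ z ≠ 0 → ∃ i < k, diagIdx z = diagIdx (stair L u j) + (i : ℕ) := by
    intro z hz
    rcases hsupp' z hz with rfl | ⟨i, h1, h2, rfl⟩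
    · exact ⟨_, by omega, hdv⟩
    · exact ⟨_, by omega, hdstair i h1⟩
  have hvj : τ (stair L u j) ≠ 0 := by
    rw [hval j le_rfl (by omega)]
    split_ifs with h h'
    · rw [endL_congr (show j % 2 = 0 % 2 by omega)]; decide
    · omega
    · omega
    · exact hends j
    · omega
    · omega
  have hvt : τ (stair L u (j + k - 1)) = endL j := by
    rw [hval _ (by omega) (by omega), if_neg (by omega), if_pos (by omega)]
  have hk1 : τ (stair L u (k + 1)) = if j = 2 then endL j else 3 := by
    rw [hval _ (by omega) (by omega)]
    split_ifs <;> first | rfl | omega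
  obtain ⟨c, hc⟩ := exists_diagBoundAt (hsupp _ hqb)
  obtain ⟨d, x⟩ := b
  by_cases hbot : toggle (d, x) τ (stair L u j) = 0
  · obtain ⟨h1, ⟨rfl, -⟩ | ⟨h, h2, -⟩⟩ := removed_site hb hvj hbot
    · right; left
      rw [hval j le_rfl (by omega)] at h1
      by_cases h : j = k
      · rw [if_pos h, if_pos (Or.inl rfl), endL_congr (show j % 2 = 0 % 2 by omega),
          show (1 : Fin 4) ^^^ endL 0 = 3 by decide] at h1
        exact absurd h1 (h3 d)
      · rw [if_neg h, if_pos (Or.inl rfl), endL_eq_bondLetter] at h1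
        obtain rfl := bondLetter_injective h1
        rfl
    · exfalso
      obtain ⟨i, hi, hi'⟩ := hbound _ h2
      have hd := congrArg diagIdx h
      rw [diagIdx_add_bondDir, hi', add_assoc, ← Nat.cast_succ] at hd
      have := natCast_zmod_inj (x := diagIdx (stair L u j)) (i := 0) (j := i + 1)
        (by rw [Nat.cast_zero, add_zero]; exact hd)
        (by omega) (by omega)
      omega
  by_cases htop : toggle (d, x) τ (stair L u (j + k - 1)) = 0
  · obtain ⟨h1, ⟨rfl, h2, -⟩ | ⟨h, -⟩⟩ := removed_site hb (hvt ▸ hends j) htop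
    · exfalso
      obtain ⟨i, hi, hi'⟩ := hbound _ h2
      rw [diagIdx_add_bondDir, hdstair _ (by omega), add_assoc, ← Nat.cast_succ] at hi'
      have := natCast_zmod_inj hi' (by omega) (by omega)
      omega
    · right; right
      have hpar : (j + k - 2) % 2 = j % 2 := by omega
      have hs := stair_succ_s12 u (i := j + k - 2) (by omega)
      rw [show j + k - 2 + 1 = j + k - 1 by omega, h] at hs
      rw [hvt, ← endL_congr hpar, endL_eq_bondLetter] at h1
      obtain rfl := bondLetter_injective h1
      exact Prod.ext rfl (add_right_cancel hs)
  by_cases hv : toggle (d, x) τ (stair L u k + bondDir L false) = 0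
  · left
    obtain ⟨h1, h2⟩ := removed_site hb (by rw [hside]; decide) hv
    rw [hside] at h1
    obtain rfl : false = d := bondLetter_injective h1
    obtain ⟨rfl, h, -⟩ | ⟨h, -⟩ := h2
    · exfalso
      rcases hsupp' _ h with h | ⟨i, hi, hi', h⟩
      · exact bondDir_ne_zero hL false (by simpa using h)
      · have hd := congrArg diagIdx h
        rw [diagIdx_add_bondDir, hdv, hdstair i hi, add_assoc, ← Nat.cast_succ] at hd
        have := natCast_zmod_inj hd (by omega) (by omega)
        obtain rfl : i = k + 1 + 1 := by omega
        have hp1 : decide (k % 2 = 0) = true := by simpa using hkeven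
        have hp2 : decide ((k + 1) % 2 = 0) = false := by simp; omega
        rw [stair_succ_s12 u (by omega), stair_succ_s12 u (by omega), hp1, hp2] at h
        exact absurd (bondDir_injective hL (add_left_cancel (add_right_cancel h))) (by decide)
    · exact Prod.ext rfl (add_right_cancel h.symm)
  · exfalso
    have hv' : toggle (d, x) τ (stair L u (k + 1)) ≠ 0 := by
      intro h0
      by_cases hj2 : j = 2
      · exact htop (by rwa [show j + k - 1 = k + 1 by omega])
      · rw [if_neg hj2] at hk1
        have := (removed_site hb (by rw [hk1]; decide) h0).1
        rw [hk1] at this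
        exact h3 d this
    have hdt : diagIdx (stair L u (j + k - 1)) = diagIdx (stair L u j) + (k - 1 : ℕ) := by
      rw [hdstair _ (by omega)]; congr 2; omega
    have hw := diagBoundAt_of_apart hkL hc hbot htop hdt
    exact hqb (coeff_eq_zero_of_two_sites hJx hJy (by omega) hkL hsupp hcons (k + 1 - j) (by omega)
      _ _ ((diagBoundAt_iff (by omega) _ _).1 hw) hbot rfl htop hdt
      (side_site_ne_stair u hkeven hj1 hjk (by omega) (by omega) (by omega)) hv hv' hdv
      (hdstair _ (by omega)))

/-- The coefficient equation of `sideSpec`. -/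
theorem sideSpec_equation {L : ℕ} [NeZero L] {Jx Jy : ℝ} (hJx : Jx ≠ 0) (hJy : Jy ≠ 0) {k : ℕ}
    (hkeven : k % 2 = 0) (hk : 4 ≤ k) (hkL : 2 * k ≤ L) {q : PSpec L → ℂ}
    (hsupp : ∀ σ : PSpec L, q σ ≠ 0 → Diag L σ ≤ k)
    (hcons : opComm L (Hcompass L Jx Jy) (Qop L q) = 0) (u : Site L) {j : ℕ} (hj : 2 ≤ j)
    (hjk : j ≤ k) :
    (Jx : ℂ) * (if j = k then 1 else -1) * q (Cspec L k j u)
      + (coupling Jx Jy (decide (j % 2 = 0)) : ℂ)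
        * ((if j = k then 0 else if j = k - 1 then -1 else if j % 2 = 0 then -1 else 1)
              * sideCoeff q k (j + 1) u
            + (if j = 2 then 0 else if j % 2 = 0 then -1 else 1) * sideCoeff q k j u) = 0 := by
  have hj1 : 1 ≤ j := by omega
  have hpar : (j + k - 2) % 2 = j % 2 := by omega
  have hval := fun i (hi : j ≤ i) (hiL : i < j + L) =>
    (sideSpec_stair u hkeven hj1 hjk hk hkL hi hiL).trans
      (by rw [Cspec_stair u hj1 hkeven (by omega) hkL hi hiL])
  have hsum := sum_bonds_subset (by omega) hcons (sideSpec L k j u)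
    {sideBond L u k, stairBond L u j, stairBond L u (j + k - 2)} fun b hb hqb => by
      simpa using bond_of_sideSpec hJx hJy hkeven hk hkL hsupp hcons u hj hjk hb hqb
  have hne : ∀ i, j ≤ i → i < j + L → sideBond L u k ≠ stairBond L u i := by
    intro i hi hiL h
    have h1 := (stair_inj_s12 u hj1 hjk hi (by omega) hiL).1 (congrArg Prod.snd h)
    have h2 := congrArg Prod.fst h
    simp [sideBond, stairBond, ← h1, hkeven] at h2
  have hne' : stairBond L u j ≠ stairBond L u (j + k - 2) := by
    intro h
    have := (stair_inj_s12 u hj1 le_rfl (by omega) (by omega) (by omega)).1 (congrArg Prod.snd h)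
    omega
  have hletters : ∀ i, endL i = 1 ∧ i % 2 ≠ 0 ∨ endL i = 2 ∧ i % 2 = 0 := fun i => by
    rcases Nat.mod_two_eq_zero_or_one i with h | h <;> simp [endL, h]
  have hval1 : sideSpec L k j u (stair L u j) = if j = k then 3 else endL j := by
    rw [hval j le_rfl (by omega), if_pos (Or.inl rfl)]
    split_ifs with h
    · rw [endL_congr (show j % 2 = 0 % 2 by omega)]; decide
    · rfl
  have hmid : ∀ i, j < i → i < j + k - 1 →
      sideSpec L k j u (stair L u i) = if i = k then 2 else 3 := by
    intro i hi hi'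
    rw [hval i hi.le (by omega), if_neg (show ¬(i = j ∨ i = j + k - 1) by omega), if_pos hi']
    rfl
  have hval2 : sideSpec L k j u (stair L u (j + 1)) = if j = k - 1 then 2 else 3 :=
    (hmid _ (by omega) (by omega)).trans (if_congr (by omega) rfl rfl)
  have hval3 : sideSpec L k j u (stair L u (j + k - 2)) = if j = 2 then 2 else 3 :=
    (hmid _ (by omega) (by omega)).trans (if_congr (by omega) rfl rfl)
  have hval4 : sideSpec L k j u (stair L u (j + k - 2 + 1)) = endL j := by
    rw [hval _ (by omega) (by omega), if_neg (by omega), if_pos (by omega)]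
  have hs1 : bondSign (sideBond L u k) (sideSpec L k j u) = if j = k then 1 else -1 := by
    refine (congrArg (pairSign 1 (sideSpec L k j u (stair L u k)))
      (sideSpec_side u hkeven hj1 hjk hk hkL)).trans ?_
    rcases eq_or_ne j k with rfl | hne
    · rw [hval1, if_pos rfl, if_pos rfl]; decide
    · rw [hmid k (by omega) (by omega), if_pos rfl, if_neg hne]; decide
  have hs2 : bondSign (stairBond L u j) (sideSpec L k j u)
      = if j = k then 0 else if j = k - 1 then -1 else if j % 2 = 0 then -1 else 1 := by
    rw [bondSign_stairBond u _ hj1, hval1, hval2]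
    rcases hletters j with ⟨h, h'⟩ | ⟨h, h'⟩ <;> rw [h] <;>
      split_ifs <;> first | omega | decide
  have hs3 : bondSign (stairBond L u (j + k - 2)) (sideSpec L k j u)
      = if j = 2 then 0 else if j % 2 = 0 then -1 else 1 := by
    rw [bondSign_stairBond u _ (by omega), hval3, hval4, endL_congr hpar]
    rcases hletters j with ⟨h, h'⟩ | ⟨h, h'⟩ <;> rw [h] <;>
      split_ifs <;> first | omega | decide
  rw [Finset.sum_insert (by simp [hne j le_rfl (by omega), hne (j + k - 2) (by omega) (by omega)]),
    Finset.sum_pair hne', hs1, hs2, hs3, toggle_sideSpec_eq u hj1 hkeven hk hkL, sideSpec,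
    sideSpec, toggle_toggle_self] at hsum
  have hc1 : coupling Jx Jy (sideBond L u k).1 = Jx := rfl
  have hc2 : (stairBond L u (j + k - 2)).1 = decide (j % 2 = 0) := by simp only [stairBond, hpar]
  have hc3 : (stairBond L u j).1 = decide (j % 2 = 0) := rfl
  rw [hc1, hc2, hc3] at hsum
  push_cast at hsum
  simp only [sideCoeff, sideSpec]
  linear_combination hsum

/-- The coefficients of the standard-form products of even length vanish. -/
theorem coeff_Cspec_eq_zero {L : ℕ} [NeZero L] {Jx Jy : ℝ} (hJx : Jx ≠ 0) (hJy : Jy ≠ 0) {k : ℕ}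
    (hkeven : k % 2 = 0) (hk : 4 ≤ k) (hkL : 2 * k ≤ L) {q : PSpec L → ℂ}
    (hsupp : ∀ σ : PSpec L, q σ ≠ 0 → Diag L σ ≤ k)
    (hcons : opComm L (Hcompass L Jx Jy) (Qop L q) = 0) (u : Site L) {j : ℕ} (hj : 1 ≤ j) :
    q (Cspec L k j u) = 0 := by
  have hJ : ∀ d, (coupling Jx Jy d : ℂ) ≠ 0 := by
    intro d; cases d <;> simpa [coupling]
  obtain ⟨x, hx⟩ : ∃ x : ℂ, ∀ j, 1 ≤ j →
      q (Cspec L k j u) = coupling Jx Jy (decide (j % 2 = 0)) * x := by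
    refine ⟨q (Cspec L k 1 u) / Jx, fun j hj => ?_⟩
    have hJx' : (Jx : ℂ) ≠ 0 := hJ false
    induction j, hj using Nat.le_induction with
    | base => simp [coupling]; field_simp
    | succ j hj ih =>
      have h := coupling_mul_coeff_succ hkeven hk hkL hsupp hcons u hj
      rw [ih] at h
      apply mul_left_cancel₀ (hJ (decide (j % 2 = 0)))
      rw [h]; ring
  have heq : ∀ j, 2 ≤ j → j ≤ k → (if j = k then 1 else -1) * (Jx * x)
      + ((if j = k then 0 else if j = k - 1 then -1 else if j % 2 = 0 then -1 else 1)
              * sideCoeff q k (j + 1) u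
            + (if j = 2 then 0 else if j % 2 = 0 then -1 else 1) * sideCoeff q k j u) = 0 := by
    intro j hj hjk
    have h := sideSpec_equation hJx hJy hkeven hk hkL hsupp hcons u hj hjk
    rw [hx j (by omega)] at h
    apply mul_left_cancel₀ (hJ (decide (j % 2 = 0)))
    linear_combination h
  have hchain : ∀ i, i + 4 ≤ k → sideCoeff q k (k - 1 - i) u
      = (if i % 2 = 0 then 1 else -1) * (i + 2) * (Jx * x) := by
    intro i hi
    induction i with
    | zero =>
      have h1 := heq k (by omega) le_rfl
      have h2 := heq (k - 1) (by omega) (by omega)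
      rw [if_pos rfl, if_pos rfl, if_neg (by omega), if_pos hkeven] at h1
      rw [if_neg (by omega), if_neg (by omega), if_pos rfl, if_neg (by omega), if_neg (by omega),
        Nat.sub_add_cancel (by omega)] at h2
      simp only [Nat.sub_zero, Nat.zero_mod, if_true, Nat.cast_zero]
      linear_combination h2 - h1
    | succ i ih =>
      have h := heq (k - 1 - (i + 1)) (by omega) (by omega)
      rw [show k - 1 - (i + 1) + 1 = k - 1 - i by omega, ih (by omega)] at h
      simp only [show k - 1 - (i + 1) ≠ k by omega, show k - 1 - (i + 1) ≠ k - 1 by omega,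
        show k - 1 - (i + 1) ≠ 2 by omega, if_false] at h
      push_cast
      rcases Nat.mod_two_eq_zero_or_one i with hi2 | hi2
      · rw [if_pos (by omega), if_pos hi2] at h
        rw [if_neg (by omega)]
        linear_combination -h
      · rw [if_neg (by omega), if_neg (by omega)] at h
        rw [if_pos (by omega)]
        linear_combination h
  have h3 := hchain (k - 4) (by omega)
  rw [show k - 1 - (k - 4) = 2 + 1 by omega, if_pos (by omega)] at h3
  have h2 := heq 2 le_rfl (by omega)
  rw [if_neg (by omega), if_neg (by omega), if_neg (by omega), if_pos rfl, if_pos rfl, h3] at h2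
  have hcast : ((k - 4 : ℕ) : ℂ) + 2 + 1 = ((k - 1 : ℕ) : ℂ) := by
    rw [show k - 1 = k - 4 + 3 by omega]; push_cast; ring
  have hz : ((k - 1 : ℕ) : ℂ) * (Jx * x) = 0 := by
    rw [← hcast]; linear_combination -h2
  have hk0 : ((k - 1 : ℕ) : ℂ) ≠ 0 := Nat.cast_ne_zero.2 (by omega)
  have hx0 : x = 0 := by
    simpa [hk0, hJx] using hz
  rw [hx j hj, hx0, mul_zero]

/-- For even `k̄` with `4 ≤ k̄ ≤ L/2`, the coefficients of the
standard-form products in a local conserved quantity satisfy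
`q_{C^k̄_j} = q_{C^k̄_1}` for odd `j` and `q_{C^k̄_j} = κ q_{C^k̄_1}` for even `j`,
where `κ = Jx/Jy`. -/
theorem standard_form_coefficients_even_k
    (L : ℕ) [NeZero L] (Jx Jy : ℝ) (hJx : Jx ≠ 0) (hJy : Jy ≠ 0)
    (k : ℕ) (heven : k % 2 = 0) (hk : 4 ≤ k) (hkL : 2 * k ≤ L)
    (q : PSpec L → ℂ)
    (hsupp : ∀ σ : PSpec L, q σ ≠ 0 → σ ≠ 0 ∧ Diag L σ ≤ k)
    (hcons : opComm L (Hcompass L Jx Jy) (Qop L q) = 0)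
    (u1 : Site L) (j : ℕ) (hj : 1 ≤ j) :
    (j % 2 = 1 → q (Cspec L k j u1) = q (Cspec L k 1 u1)) ∧
    (j % 2 = 0 → q (Cspec L k j u1) = ((Jx / Jy : ℝ) : ℂ) * q (Cspec L k 1 u1)) := by
  have h0 := fun i (hi : 1 ≤ i) => coeff_Cspec_eq_zero hJx hJy heven hk hkL
    (fun σ hσ => (hsupp σ hσ).2) hcons u1 (j := i) hi
  simp [h0 j hj, h0 1 le_rfl]
end
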